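/- arXiv:math/0604201 — 7 statements merged into one kernel-verified Lean document; each statement's English description precedes it below -/
import Mathlib

section
/- Let f be a monotone (nondecreasing or nonincreasing) convex real function defined on an interval (a,b), let A be an n×n Hermitian complex matrix whose spectrum lies in (a,b), and let V be an n×d complex matrix with V*V = I_d (so V is an isometry onto a d-dimensional subspace E, and the compression of a matrix X onto E is X_E = V*XV). Then there exists a d×d unitary matrix U such that f(V*AV) ≤ U (V* f(A) V) U* in the Loewner order. -/
open Matrix ComplexOrder

/-- Functional calculus: apply `f : ℝ → ℝ` to a Hermitian matrix via its spectral
decomposition `A = Σ λ_k u_k u_k*`, i.e. `f(A) = Σ f(λ_k) u_k u_k*`;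
junk value `0` if the matrix is not Hermitian. -/
noncomputable def matFun {n : ℕ} (A : Matrix (Fin n) (Fin n) ℂ) (f : ℝ → ℝ) :
    Matrix (Fin n) (Fin n) ℂ :=
  if h : A.IsHermitian then
    (h.eigenvectorUnitary : Matrix (Fin n) (Fin n) ℂ) *
      Matrix.diagonal (fun i => (f (h.eigenvalues i) : ℂ)) *
      star (h.eigenvectorUnitary : Matrix (Fin n) (Fin n) ℂ)
  else 0

/-- The functional calculus at the identity function is the identity. -/
theorem matFun_id {n : ℕ} {M : Matrix (Fin n) (Fin n) ℂ} (hM : M.IsHermitian) :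
    matFun M id = M := by
  rw [matFun, dif_pos hM]
  conv_rhs => rw [hM.spectral_theorem]
  rfl

/-- A Hermitian matrix can be diagonalized so that the values of `f` along the list of
eigenvalues are in nonincreasing order. -/
theorem exists_diagonalization_antitone {n : ℕ} {M : Matrix (Fin n) (Fin n) ℂ}
    (hM : M.IsHermitian) (f : ℝ → ℝ) :
    ∃ (W : Matrix (Fin n) (Fin n) ℂ) (μ : Fin n → ℝ), Wᴴ * W = 1 ∧ W * Wᴴ = 1 ∧
      (∀ g : ℝ → ℝ, matFun M g = W * diagonal (fun i => (g (μ i) : ℂ)) * Wᴴ) ∧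
      Antitone (fun i => f (μ i)) ∧ ∀ i, ∃ j, μ i = hM.eigenvalues j := by
  let σ : Equiv.Perm (Fin n) := Tuple.sort (fun i => -f (hM.eigenvalues i))
  have hσ : Monotone ((fun i => -f (hM.eigenvalues i)) ∘ σ) := Tuple.monotone_sort _
  let W₀ : Matrix (Fin n) (Fin n) ℂ := hM.eigenvectorUnitary
  have h₁ : W₀ᴴ * W₀ = 1 := Unitary.coe_star_mul_self hM.eigenvectorUnitary
  have h₂ : W₀ * W₀ᴴ = 1 := Unitary.coe_mul_star_self hM.eigenvectorUnitary
  refine ⟨W₀.submatrix id σ, fun i => hM.eigenvalues (σ i), ?_, ?_, fun g => ?_,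
    fun i j hij => neg_le_neg_iff.mp (hσ hij), fun i => ⟨σ i, rfl⟩⟩
  · rw [conjTranspose_submatrix, ← submatrix_mul _ _ _ _ _ Function.bijective_id, h₁,
      submatrix_one_equiv]
  · rw [conjTranspose_submatrix, ← submatrix_mul _ _ _ _ _ σ.bijective, h₂, submatrix_id_id]
  · have hd : diagonal (fun i => (g (hM.eigenvalues (σ i)) : ℂ)) =
        (diagonal fun i => (g (hM.eigenvalues i) : ℂ)).submatrix σ σ :=
      (submatrix_diagonal_equiv (fun i => (g (hM.eigenvalues i) : ℂ)) σ).symm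
    rw [hd, conjTranspose_submatrix, ← submatrix_mul _ _ _ _ _ σ.bijective,
      ← submatrix_mul _ _ _ _ _ σ.bijective, submatrix_id_id, matFun, dif_pos hM]
    rfl

/-- The quadratic form of `W diag(μ) Wᴴ` in the coordinates given by the columns of `W`. -/
theorem star_dotProduct_mul_diagonal_mul {m : ℕ} (W : Matrix (Fin m) (Fin m) ℂ) (μ : Fin m → ℝ)
    (x : Fin m → ℂ) :
    star x ⬝ᵥ (W * diagonal (fun i => (μ i : ℂ)) * Wᴴ) *ᵥ x =
      ((∑ i, Complex.normSq ((Wᴴ *ᵥ x) i) * μ i : ℝ) : ℂ) := by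
  have hstar : star x ᵥ* W = star (Wᴴ *ᵥ x) := by
    rw [star_mulVec, conjTranspose_conjTranspose]
  rw [← mulVec_mulVec, ← mulVec_mulVec, dotProduct_mulVec, hstar]
  simp only [dotProduct, mulVec_diagonal, Pi.star_apply, Complex.ofReal_sum, Complex.ofReal_mul,
    Complex.normSq_eq_conj_mul_self]
  exact Finset.sum_congr rfl fun i _ => by rw [Complex.star_def]; ring

/-- The coordinates with respect to a unitary matrix have the same sum of squared moduli. -/
theorem sum_normSq_conjTranspose_mulVec {m : ℕ} {W : Matrix (Fin m) (Fin m) ℂ}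
    (hW : W * Wᴴ = 1) (x : Fin m → ℂ) :
    ((∑ i, Complex.normSq ((Wᴴ *ᵥ x) i) : ℝ) : ℂ) = star x ⬝ᵥ x := by
  have h := star_dotProduct_mul_diagonal_mul W (fun _ => 1) x
  simpa [hW] using h.symm

/-- Given two square matrices, some unit vector has vanishing coordinates after the index `i` for
the first one and before `i` for the second one. -/
theorem exists_unit_vector_coords_eq_zero {d : ℕ} (P Q : Matrix (Fin d) (Fin d) ℂ) (i : Fin d) :
    ∃ x : Fin d → ℂ, star x ⬝ᵥ x = 1 ∧ (∀ j, i < j → (P *ᵥ x) j = 0) ∧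
      ∀ j, j < i → (Q *ᵥ x) j = 0 := by
  let L : (Fin d → ℂ) →ₗ[ℂ] ({j : Fin d // j ≠ i} → ℂ) :=
    LinearMap.pi fun j => if i < j.1 then LinearMap.proj j.1 ∘ₗ P.mulVecLin
      else LinearMap.proj j.1 ∘ₗ Q.mulVecLin
  have hlt : Module.finrank ℂ ({j : Fin d // j ≠ i} → ℂ) < Module.finrank ℂ (Fin d → ℂ) := by
    rw [Module.finrank_fintype_fun_eq_card, Module.finrank_fintype_fun_eq_card]
    exact Fintype.card_subtype_lt (x := i) (by simp)
  obtain ⟨y, hyL, hy⟩ :=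
    (Submodule.ne_bot_iff _).mp (LinearMap.ker_ne_bot_of_finrank_lt (f := L) hlt)
  have hcoord : ∀ j (hj : j ≠ i), L y ⟨j, hj⟩ = 0 := fun j hj => by
    rw [LinearMap.mem_ker.mp hyL]; rfl
  let N : ℝ := ∑ j, Complex.normSq (y j)
  have hN : star y ⬝ᵥ y = (N : ℂ) := by
    simp [N, dotProduct, Complex.normSq_eq_conj_mul_self]
  have hN_pos : 0 < N := by
    have h := dotProduct_star_self_pos_iff.mpr hy
    rw [hN] at h
    exact_mod_cast h
  refine ⟨((Real.sqrt N)⁻¹ : ℂ) • y, ?_, fun j hj => ?_, fun j hj => ?_⟩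
  · have hs : ((Real.sqrt N : ℝ) : ℂ) * (Real.sqrt N : ℝ) = N := by
      rw [← Complex.ofReal_mul, Real.mul_self_sqrt hN_pos.le]
    have hs₀ : ((Real.sqrt N : ℝ) : ℂ) ≠ 0 := by
      exact_mod_cast (Real.sqrt_pos.mpr hN_pos).ne'
    rw [star_smul, smul_dotProduct, dotProduct_smul, hN, ← hs]
    simp
    field_simp
  · have h := hcoord j hj.ne'
    simp only [L, LinearMap.pi_apply, if_pos hj] at h
    rw [mulVec_smul, Pi.smul_apply, show (P *ᵥ y) j = 0 from h, smul_zero]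
  · have h := hcoord j hj.ne
    simp only [L, LinearMap.pi_apply, if_neg hj.not_gt] at h
    rw [mulVec_smul, Pi.smul_apply, show (Q *ᵥ y) j = 0 from h, smul_zero]

/-- The quadratic form of a compression. -/
theorem star_dotProduct_compression {n d : ℕ} (M : Matrix (Fin n) (Fin n) ℂ)
    (V : Matrix (Fin n) (Fin d) ℂ) (x : Fin d → ℂ) :
    star x ⬝ᵥ (Vᴴ * M * V) *ᵥ x = star (V *ᵥ x) ⬝ᵥ M *ᵥ (V *ᵥ x) := by
  rw [← mulVec_mulVec, ← mulVec_mulVec, dotProduct_mulVec, ← star_mulVec]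

/-- A function of a Hermitian matrix is Hermitian. -/
theorem isHermitian_matFun {n : ℕ} (M : Matrix (Fin n) (Fin n) ℂ) (f : ℝ → ℝ) :
    (matFun M f).IsHermitian := by
  rw [matFun]
  split_ifs with h
  · refine isHermitian_mul_mul_conjTranspose _ (isHermitian_diagonal_of_self_adjoint _ ?_)
    ext i
    simp
  · exact isHermitian_zero

/-- for a monotone convex function `f` on `(a,b)`, a Hermitian matrix `A`
with spectrum in `(a,b)` and an isometry `V` (`VᴴV = 1`), there is a unitary `U` with
`f(VᴴAV) ≤ U (Vᴴ f(A) V) Uᴴ` in the Loewner order. -/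
theorem compression_monotone_convex {n d : ℕ} {a b : ℝ} {f : ℝ → ℝ}
    (hconv : ConvexOn ℝ (Set.Ioo a b) f)
    (hmono : MonotoneOn f (Set.Ioo a b) ∨ AntitoneOn f (Set.Ioo a b))
    (A : Matrix (Fin n) (Fin n) ℂ) (hA : A.IsHermitian)
    (hspec : ∀ i, hA.eigenvalues i ∈ Set.Ioo a b)
    (V : Matrix (Fin n) (Fin d) ℂ) (hV : Vᴴ * V = 1) :
    ∃ U : Matrix (Fin d) (Fin d) ℂ, Uᴴ * U = 1 ∧
      (U * (Vᴴ * matFun A f * V) * Uᴴ - matFun (Vᴴ * A * V) f).PosSemidef := by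
  have hB : (Vᴴ * A * V).IsHermitian := isHermitian_conjTranspose_mul_mul V hA
  have hC : (Vᴴ * matFun A f * V).IsHermitian :=
    isHermitian_conjTranspose_mul_mul V (isHermitian_matFun A f)
  obtain ⟨Y, α, -, hY, hfA, -, hα⟩ := exists_diagonalization_antitone hA f
  obtain ⟨W, β, hW', hW, hfB, hβ, -⟩ := exists_diagonalization_antitone hB f
  obtain ⟨Z, γ, hZ', hZ, hfC, hγ, -⟩ := exists_diagonalization_antitone hC id
  have hA_eq := hfA id
  have hB_eq := hfB id
  have hC_eq := hfC id
  rw [matFun_id hA] at hA_eq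
  rw [matFun_id hB] at hB_eq
  rw [matFun_id hC] at hC_eq
  have hα_mem : ∀ k, α k ∈ Set.Ioo a b := fun k => by
    obtain ⟨j, hj⟩ := hα k
    exact hj ▸ hspec j
  have hV_norm : ∀ x : Fin d → ℂ, star (V *ᵥ x) ⬝ᵥ (V *ᵥ x) = star x ⬝ᵥ x := fun x => by
    rw [star_mulVec, ← dotProduct_mulVec, mulVec_mulVec, hV, one_mulVec]
  have hsum_Y : ∀ x : Fin d → ℂ, star x ⬝ᵥ x = 1 →
      ∑ k, Complex.normSq ((Yᴴ *ᵥ (V *ᵥ x)) k) = 1 := fun x hx => by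
    have h := sum_normSq_conjTranspose_mulVec hY (V *ᵥ x)
    rw [hV_norm, hx] at h
    exact_mod_cast h
  have hquad : ∀ x : Fin d → ℂ, ∑ j, Complex.normSq ((Wᴴ *ᵥ x) j) * β j =
      ∑ k, Complex.normSq ((Yᴴ *ᵥ (V *ᵥ x)) k) * α k := fun x => by
    have h₁ := star_dotProduct_mul_diagonal_mul W β x
    have h₂ := star_dotProduct_mul_diagonal_mul Y α (V *ᵥ x)
    simp only [id] at hA_eq hB_eq
    rw [← hB_eq, star_dotProduct_compression] at h₁
    rw [← hA_eq, h₁] at h₂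
    exact_mod_cast h₂
  have hquad_f : ∀ x : Fin d → ℂ, ∑ j, Complex.normSq ((Zᴴ *ᵥ x) j) * γ j =
      ∑ k, Complex.normSq ((Yᴴ *ᵥ (V *ᵥ x)) k) * f (α k) := fun x => by
    have h₁ := star_dotProduct_mul_diagonal_mul Z γ x
    have h₂ := star_dotProduct_mul_diagonal_mul Y (fun k => f (α k)) (V *ᵥ x)
    simp only [id] at hC_eq
    rw [← hC_eq, star_dotProduct_compression] at h₁
    rw [← hfA f, h₁] at h₂
    exact_mod_cast h₂
  have hβ_mem : ∀ j, β j ∈ Set.Ioo a b := fun j => by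
    have hx : Wᴴ *ᵥ (W *ᵥ Pi.single j 1) = Pi.single j 1 := by
      rw [mulVec_mulVec, hW', one_mulVec]
    have hx₁ : star (W *ᵥ Pi.single j 1) ⬝ᵥ (W *ᵥ Pi.single j 1) = 1 := by
      rw [star_mulVec, ← dotProduct_mulVec, hx]
      simp
    have h := hquad (W *ᵥ Pi.single j 1)
    rw [hx, Finset.sum_eq_single j (by intro k _ hk; simp [hk]) (by simp)] at h
    rw [Pi.single_eq_same, map_one, one_mul] at h
    rw [h]
    exact (convex_Ioo a b).sum_mem (fun _ _ => Complex.normSq_nonneg _) (hsum_Y _ hx₁)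
      fun k _ => hα_mem k
  have hquasi : QuasiconcaveOn ℝ (Set.Ioo a b) f :=
    hmono.elim (fun h => h.quasiconcaveOn (convex_Ioo a b))
      fun h => h.quasiconcaveOn (convex_Ioo a b)
  have hle : ∀ i, f (β i) ≤ γ i := fun i => by
    obtain ⟨x, hx, hxW, hxZ⟩ := exists_unit_vector_coords_eq_zero Wᴴ Zᴴ i
    have hW_sum : ∑ j, Complex.normSq ((Wᴴ *ᵥ x) j) = 1 := by
      exact_mod_cast (sum_normSq_conjTranspose_mulVec hW x).trans hx
    have hZ_sum : ∑ j, Complex.normSq ((Zᴴ *ᵥ x) j) = 1 := by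
      exact_mod_cast (sum_normSq_conjTranspose_mulVec hZ x).trans hx
    have hlow : f (β i) ≤ f (∑ j, Complex.normSq ((Wᴴ *ᵥ x) j) * β j) := by
      have hsum : ∑ j with j ≤ i, Complex.normSq ((Wᴴ *ᵥ x) j) = 1 := by
        rw [← hW_sum]
        refine Finset.sum_subset (Finset.filter_subset _ _) fun j _ hj => ?_
        simp [hxW j (by simpa using hj)]
      have heq : ∑ j, Complex.normSq ((Wᴴ *ᵥ x) j) * β j =
          ∑ j with j ≤ i, Complex.normSq ((Wᴴ *ᵥ x) j) • β j := by
        refine (Finset.sum_subset (Finset.filter_subset _ _) fun j _ hj => ?_).symm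
        simp [hxW j (by simpa using hj)]
      rw [heq]
      exact ((hquasi (f (β i))).sum_mem (fun _ _ => Complex.normSq_nonneg _) hsum
        fun j hj => ⟨hβ_mem j, hβ (Finset.mem_filter.mp hj).2⟩).2
    have hjensen : f (∑ k, Complex.normSq ((Yᴴ *ᵥ (V *ᵥ x)) k) * α k) ≤
        ∑ k, Complex.normSq ((Yᴴ *ᵥ (V *ᵥ x)) k) * f (α k) :=
      hconv.map_sum_le (fun _ _ => Complex.normSq_nonneg _) (hsum_Y x hx) fun k _ => hα_mem k
    have hup : ∑ j, Complex.normSq ((Zᴴ *ᵥ x) j) * γ j ≤ γ i := by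
      calc ∑ j, Complex.normSq ((Zᴴ *ᵥ x) j) * γ j
          ≤ ∑ j, Complex.normSq ((Zᴴ *ᵥ x) j) * γ i := by
            refine Finset.sum_le_sum fun j _ => ?_
            rcases lt_or_ge j i with hj | hj
            · simp [hxZ j hj]
            · exact mul_le_mul_of_nonneg_left (hγ hj) (Complex.normSq_nonneg _)
        _ = γ i := by rw [← Finset.sum_mul, hZ_sum, one_mul]
    rw [hquad x] at hlow
    rw [hquad_f x] at hup
    exact hlow.trans (hjensen.trans hup)
  refine ⟨W * Zᴴ, ?_, ?_⟩
  · rw [conjTranspose_mul, conjTranspose_conjTranspose, Matrix.mul_assoc, ← Matrix.mul_assoc Wᴴ,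
      hW', Matrix.one_mul, hZ]
  · have hconj : W * Zᴴ * (Vᴴ * matFun A f * V) * (W * Zᴴ)ᴴ =
        W * diagonal (fun i => (γ i : ℂ)) * Wᴴ := by
      rw [hC_eq, conjTranspose_mul, conjTranspose_conjTranspose]
      calc W * Zᴴ * (Z * diagonal (fun i => (γ i : ℂ)) * Zᴴ) * (Z * Wᴴ)
          = W * (Zᴴ * Z) * diagonal (fun i => (γ i : ℂ)) * (Zᴴ * Z) * Wᴴ := by
            simp only [Matrix.mul_assoc]
        _ = W * diagonal (fun i => (γ i : ℂ)) * Wᴴ := by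
            rw [hZ', Matrix.mul_one, Matrix.mul_one]
    rw [hconj, hfB f, ← Matrix.sub_mul, ← Matrix.mul_sub, diagonal_sub]
    refine PosSemidef.mul_mul_conjTranspose_same (PosSemidef.diagonal fun i => ?_) W
    simpa using hle i
end

section
/- Let A be a positive semidefinite n×n complex matrix with eigenvalues λ_1(A) ≥ … ≥ λ_n(A) and an orthonormal basis of eigenvectors f_1, …, f_n with A f_j = λ_j(A) f_j. Let V be an n×d complex matrix with V*V = I_d whose range E satisfies E ∩ span{f_j : j > d} = {0}. Then for every integer k with 1 ≤ k ≤ d, lim_{p→∞} λ_k( (V* A^p V)^{1/p} ) = λ_k(A). -/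
open Matrix ComplexOrder

/-- The `k`-th largest eigenvalue (`k` is 0-indexed, eigenvalues counted with
multiplicity) of a Hermitian matrix; junk value `0` if the matrix is not Hermitian. -/
noncomputable def kthEig {n : ℕ} (M : Matrix (Fin n) (Fin n) ℂ) (k : Fin n) : ℝ :=
  if h : M.IsHermitian then (h.eigenvalues ∘ Tuple.sort h.eigenvalues) k.rev else 0

/-- A Hermitian matrix is unitarily diagonalised with eigenvalues in decreasing order, and
`kthEig` reads off the diagonal. -/
theorem exists_antitone_diagonalization {n : ℕ} {M : Matrix (Fin n) (Fin n) ℂ}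
    (hM : M.IsHermitian) :
    ∃ (X : Matrix (Fin n) (Fin n) ℂ) (ν : Fin n → ℝ), Xᴴ * X = 1 ∧ Antitone ν ∧
      M = X * diagonal (fun i => (ν i : ℂ)) * Xᴴ ∧ ∀ k, kthEig M k = ν k := by
  let σ : Equiv.Perm (Fin n) := Fin.revPerm.trans (Tuple.sort hM.eigenvalues)
  let W : Matrix (Fin n) (Fin n) ℂ := hM.eigenvectorUnitary
  have hW : Wᴴ * W = 1 := Unitary.coe_star_mul_self hM.eigenvectorUnitary
  refine ⟨W.submatrix id σ, hM.eigenvalues ∘ σ, ?_, ?_, ?_, ?_⟩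
  · rw [conjTranspose_submatrix, ← submatrix_mul _ _ _ id _ Function.bijective_id, hW,
      submatrix_one_equiv]
  · intro i j hij
    exact Tuple.monotone_sort hM.eigenvalues (Fin.rev_le_rev.mpr hij)
  · have hd : diagonal (fun i => (((hM.eigenvalues ∘ σ) i : ℝ) : ℂ)) =
        (diagonal (fun i => (hM.eigenvalues i : ℂ))).submatrix σ σ := by
      rw [submatrix_diagonal_equiv]; rfl
    rw [hd, conjTranspose_submatrix, submatrix_mul_equiv, submatrix_mul_equiv, submatrix_id_id]
    exact hM.spectral_theorem
  · intro k
    rw [kthEig, dif_pos hM]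
    rfl

theorem isHermitian_unitary_diagonal {m n : ℕ} (X : Matrix (Fin m) (Fin n) ℂ) (ν : Fin n → ℝ) :
    (X * diagonal (fun i => (ν i : ℂ)) * Xᴴ).IsHermitian := by
  refine isHermitian_mul_mul_conjTranspose X ?_
  rw [isHermitian_diagonal_iff]
  intro i
  exact Complex.conj_ofReal _

/-- The functional calculus can be computed from any unitary diagonalisation. -/
theorem matFun_eq_of_diagonalization {n : ℕ} {X : Matrix (Fin n) (Fin n) ℂ} (hX : Xᴴ * X = 1)
    (ν : Fin n → ℝ) (f : ℝ → ℝ) :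
    matFun (X * diagonal (fun i => (ν i : ℂ)) * Xᴴ) f =
      X * diagonal (fun i => (f (ν i) : ℂ)) * Xᴴ := by
  have hM := isHermitian_unitary_diagonal X ν
  set M := X * diagonal (fun i => (ν i : ℂ)) * Xᴴ with hMdef
  have hX' : X * Xᴴ = 1 := mul_eq_one_comm.mp hX
  rw [matFun, dif_pos hM]
  set W := (hM.eigenvectorUnitary : Matrix (Fin n) (Fin n) ℂ)
  have hW : star W * W = 1 := Unitary.coe_star_mul_self hM.eigenvectorUnitary
  have hW' : W * star W = 1 := mul_eq_one_comm.mp hW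
  have hspec : M = W * diagonal (fun i => (hM.eigenvalues i : ℂ)) * star W := hM.spectral_theorem
  have key : diagonal (fun i => (hM.eigenvalues i : ℂ)) * (star W * X) =
      (star W * X) * diagonal (fun i => (ν i : ℂ)) := by
    have h1 : star W * M * X = diagonal (fun i => (hM.eigenvalues i : ℂ)) * (star W * X) := by
      conv_lhs => rw [hspec]
      simp only [← mul_assoc, hW, one_mul]
    rw [← h1, hMdef]
    simp only [mul_assoc, hX, mul_one]
  have key' : diagonal (fun i => (f (hM.eigenvalues i) : ℂ)) * (star W * X) =
      (star W * X) * diagonal (fun i => (f (ν i) : ℂ)) := by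
    ext i j
    have h := congrFun (congrFun key i) j
    rw [diagonal_mul, mul_diagonal, mul_comm] at h
    rw [diagonal_mul, mul_diagonal, mul_comm]
    rcases mul_eq_mul_left_iff.mp h with h | h
    · rw [Complex.ofReal_inj.mp h]
    · simp [h]
  calc W * diagonal (fun i => (f (hM.eigenvalues i) : ℂ)) * star W
      = W * (diagonal (fun i => (f (hM.eigenvalues i) : ℂ)) * (star W * X)) * Xᴴ := by
        simp only [mul_assoc, hX', mul_one]
    _ = X * diagonal (fun i => (f (ν i) : ℂ)) * Xᴴ := by
        rw [key']
        simp only [← mul_assoc, hW', one_mul]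

theorem re_star_dotProduct_diagonal {m n : ℕ} (Z : Matrix (Fin m) (Fin n) ℂ) (ν : Fin m → ℝ)
    (x : Fin n → ℂ) :
    (star x ⬝ᵥ (Zᴴ * diagonal (fun i => (ν i : ℂ)) * Z) *ᵥ x).re =
      ∑ j, ν j * ‖(Z *ᵥ x) j‖ ^ 2 := by
  rw [← mulVec_mulVec, ← mulVec_mulVec, dotProduct_mulVec, ← star_mulVec, dotProduct,
    Complex.re_sum]
  refine Finset.sum_congr rfl fun j _ => ?_
  rw [mulVec_diagonal, Pi.star_apply, mul_left_comm, RCLike.star_def, Complex.conj_mul',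
    Complex.re_ofReal_mul]
  norm_cast

theorem sum_norm_sq_mulVec_of_isometry {m n : ℕ} {Z : Matrix (Fin m) (Fin n) ℂ} (hZ : Zᴴ * Z = 1)
    (x : Fin n → ℂ) : ∑ j, ‖(Z *ᵥ x) j‖ ^ 2 = ∑ j, ‖x j‖ ^ 2 := by
  have h1 := re_star_dotProduct_diagonal Z (fun _ => 1) x
  have h2 := re_star_dotProduct_diagonal (1 : Matrix (Fin n) (Fin n) ℂ) (fun _ => 1) x
  simp only [Complex.ofReal_one, diagonal_one, Matrix.mul_one, one_mul, hZ, conjTranspose_one,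
    one_mulVec] at h1 h2
  rw [← h1, h2]

theorem exists_ne_zero_mulVec_eq_zero {ι : Type*} [Fintype ι] {κ : Type*} [Fintype κ] {n : ℕ}
    (C : Matrix ι (Fin n) ℂ) (D : Matrix κ (Fin n) ℂ)
    (h : Fintype.card ι + Fintype.card κ < n) :
    ∃ x : Fin n → ℂ, x ≠ 0 ∧ C *ᵥ x = 0 ∧ D *ᵥ x = 0 := by
  have hk : LinearMap.ker (C.mulVecLin.prod D.mulVecLin) ≠ ⊥ :=
    LinearMap.ker_ne_bot_of_finrank_lt (by simpa using h)
  obtain ⟨x, hx, hx0⟩ := Submodule.exists_mem_ne_zero_of_ne_bot hk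
  rw [LinearMap.mem_ker, LinearMap.prod_apply] at hx
  exact ⟨x, hx0, congrArg Prod.fst hx, congrArg Prod.snd hx⟩

theorem card_subtype_gt {n : ℕ} (k : Fin n) : Fintype.card {j : Fin n // k < j} = n - 1 - k := by
  rw [Fintype.card_subtype, Finset.filter_lt_eq_Ioi, Fin.card_Ioi]

theorem card_subtype_lt {n : ℕ} (k : Fin n) : Fintype.card {j : Fin n // j < k} = k := by
  rw [Fintype.card_subtype, Finset.filter_gt_eq_Iio, Fin.card_Iio]

theorem sum_norm_sq_pos {n : ℕ} {x : Fin n → ℂ} (hx : x ≠ 0) : 0 < ∑ j, ‖x j‖ ^ 2 := by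
  obtain ⟨i, hi⟩ := Function.ne_iff.mp hx
  have : 0 < ‖x i‖ := norm_pos_iff.mpr hi
  exact Finset.sum_pos' (fun _ _ => by positivity) ⟨i, Finset.mem_univ i, by positivity⟩

/-- Courant–Fischer upper bound: a bound on the quadratic form on the kernel of at most `k`
linear functionals bounds the eigenvalue with (zero-based) index `k`. -/
theorem eigenvalue_le_of_form_le {n : ℕ} {X : Matrix (Fin n) (Fin n) ℂ} (hX : Xᴴ * X = 1)
    {ν : Fin n → ℝ} (hν : Antitone ν) (k : Fin n) {ι : Type*} [Fintype ι]
    (C : Matrix ι (Fin n) ℂ) (hC : Fintype.card ι ≤ k) {c : ℝ}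
    (h : ∀ x, C *ᵥ x = 0 → (star x ⬝ᵥ (X * diagonal (fun i => (ν i : ℂ)) * Xᴴ) *ᵥ x).re ≤
      c * ∑ j, ‖x j‖ ^ 2) : ν k ≤ c := by
  obtain ⟨x, hx0, hCx, hDx⟩ := exists_ne_zero_mulVec_eq_zero C
    (Xᴴ.submatrix (fun j : {j : Fin n // k < j} => j.1) id) (by
      rw [card_subtype_gt]
      have := k.2
      omega)
  have hx := h x hCx
  have hf := re_star_dotProduct_diagonal Xᴴ ν x
  rw [conjTranspose_conjTranspose] at hf
  have hn := sum_norm_sq_mulVec_of_isometry (Z := Xᴴ)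
    (by rw [conjTranspose_conjTranspose]; exact mul_eq_one_comm.mp hX) x
  refine le_of_mul_le_mul_right ?_ (sum_norm_sq_pos hx0)
  refine le_trans ?_ hx
  rw [hf, ← hn, Finset.mul_sum]
  refine Finset.sum_le_sum fun j _ => ?_
  rcases le_or_gt j k with hj | hj
  · exact mul_le_mul_of_nonneg_right (hν hj) (by positivity)
  · have h0 : (Xᴴ *ᵥ x) j = 0 := congrFun hDx ⟨j, hj⟩
    simp [h0]

/-- Courant–Fischer lower bound. -/
theorem le_eigenvalue_of_le_form {n : ℕ} {X : Matrix (Fin n) (Fin n) ℂ} (hX : Xᴴ * X = 1)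
    {ν : Fin n → ℝ} (hν : Antitone ν) (k : Fin n) {ι : Type*} [Fintype ι]
    (C : Matrix ι (Fin n) ℂ) (hC : Fintype.card ι + k < n) {c : ℝ}
    (h : ∀ x, C *ᵥ x = 0 → c * ∑ j, ‖x j‖ ^ 2 ≤
      (star x ⬝ᵥ (X * diagonal (fun i => (ν i : ℂ)) * Xᴴ) *ᵥ x).re) : c ≤ ν k := by
  obtain ⟨x, hx0, hCx, hDx⟩ := exists_ne_zero_mulVec_eq_zero C
    (Xᴴ.submatrix (fun j : {j : Fin n // j < k} => j.1) id) (by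
      rw [card_subtype_lt]
      exact hC)
  have hx := h x hCx
  have hf := re_star_dotProduct_diagonal Xᴴ ν x
  rw [conjTranspose_conjTranspose] at hf
  have hn := sum_norm_sq_mulVec_of_isometry (Z := Xᴴ)
    (by rw [conjTranspose_conjTranspose]; exact mul_eq_one_comm.mp hX) x
  refine le_of_mul_le_mul_right ?_ (sum_norm_sq_pos hx0)
  refine le_trans hx ?_
  rw [hf, ← hn, Finset.mul_sum]
  refine Finset.sum_le_sum fun j _ => ?_
  rcases le_or_gt k j with hj | hj
  · exact mul_le_mul_of_nonneg_right (hν hj) (by positivity)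
  · have h0 : (Xᴴ *ᵥ x) j = 0 := congrFun hDx ⟨j, hj⟩
    simp [h0]

theorem kthEig_eq_of_diagonalization {n : ℕ} {X : Matrix (Fin n) (Fin n) ℂ} (hX : Xᴴ * X = 1)
    {ν : Fin n → ℝ} (hν : Antitone ν) (k : Fin n) :
    kthEig (X * diagonal (fun i => (ν i : ℂ)) * Xᴴ) k = ν k := by
  obtain ⟨Y, ξ, hY, hξ, hM, hk⟩ :=
    exists_antitone_diagonalization (isHermitian_unitary_diagonal X ν)
  have hY' := mul_eq_one_comm.mp hY
  rw [hk]
  have hf := re_star_dotProduct_diagonal Yᴴ ξ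
  rw [conjTranspose_conjTranspose] at hf
  have hn := sum_norm_sq_mulVec_of_isometry (Z := Yᴴ)
    (by rw [conjTranspose_conjTranspose]; exact hY')
  apply le_antisymm
  · refine le_eigenvalue_of_le_form hX hν k
      (Yᴴ.submatrix (fun j : {j : Fin n // k < j} => j.1) id) ?_ fun x hx => ?_
    · rw [card_subtype_gt]
      have := k.2
      omega
    · rw [hM, hf, ← hn, Finset.mul_sum]
      refine Finset.sum_le_sum fun j _ => ?_
      rcases le_or_gt j k with hj | hj
      · exact mul_le_mul_of_nonneg_right (hξ hj) (by positivity)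
      · have h0 : (Yᴴ *ᵥ x) j = 0 := congrFun hx ⟨j, hj⟩
        simp [h0]
  · refine eigenvalue_le_of_form_le hX hν k
      (Yᴴ.submatrix (fun j : {j : Fin n // j < k} => j.1) id) ?_ fun x hx => ?_
    · rw [card_subtype_lt]
    · rw [hM, hf, ← hn, Finset.mul_sum]
      refine Finset.sum_le_sum fun j _ => ?_
      rcases le_or_gt k j with hj | hj
      · exact mul_le_mul_of_nonneg_right (hξ hj) (by positivity)
      · have h0 : (Yᴴ *ᵥ x) j = 0 := congrFun hx ⟨j, hj⟩
        simp [h0]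

theorem exists_sum_norm_sq_le_of_injective {m n : ℕ} (Z : Matrix (Fin m) (Fin n) ℂ)
    (hZ : ∀ x, Z *ᵥ x = 0 → x = 0) :
    ∃ K : ℝ, 0 < K ∧ ∀ x, K * ∑ j, ‖x j‖ ^ 2 ≤ ∑ j, ‖(Z *ᵥ x) j‖ ^ 2 := by
  have hker : LinearMap.ker (toEuclideanLin Z) = ⊥ := by
    refine LinearMap.ker_eq_bot'.mpr fun x hx => ?_
    have := hZ (WithLp.ofLp x) (congrArg WithLp.ofLp hx)
    exact congrArg (WithLp.toLp 2) this
  obtain ⟨K, hK, h⟩ := (toEuclideanLin Z).exists_antilipschitzWith hker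
  have hK' : (0 : ℝ) < K := hK
  refine ⟨((K : ℝ) ^ 2)⁻¹, by positivity, fun x => ?_⟩
  have hx := h.le_mul_dist (WithLp.toLp 2 x) 0
  rw [map_zero, dist_zero_right, dist_zero_right] at hx
  have hsq := pow_le_pow_left₀ (norm_nonneg _) hx 2
  rw [mul_pow, EuclideanSpace.norm_sq_eq, EuclideanSpace.norm_sq_eq] at hsq
  rw [inv_mul_le_iff₀ (by positivity)]
  exact hsq

/-- The ordered eigenvalues of the compression of a nonnegative diagonal matrix are comparable to
its leading diagonal entries, with a constant depending only on the compression. -/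
theorem kthEig_compression_bounds {n d : ℕ} (hd : d ≤ n) {Z : Matrix (Fin n) (Fin d) ℂ}
    (hZ : Zᴴ * Z = 1) {K : ℝ}
    (hK : ∀ x, K * ∑ j, ‖x j‖ ^ 2 ≤ ∑ j : Fin d, ‖(Z *ᵥ x) (Fin.castLE hd j)‖ ^ 2)
    {ρ : Fin n → ℝ} (hρ : Antitone ρ) (hρ0 : ∀ i, 0 ≤ ρ i)
    {X : Matrix (Fin d) (Fin d) ℂ} (hX : Xᴴ * X = 1) {ν : Fin d → ℝ} (hν : Antitone ν)
    (hM : Zᴴ * diagonal (fun i => (ρ i : ℂ)) * Z = X * diagonal (fun i => (ν i : ℂ)) * Xᴴ)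
    (k : Fin d) :
    K * ρ (Fin.castLE hd k) ≤ ν k ∧ ν k ≤ ρ (Fin.castLE hd k) := by
  have hf := re_star_dotProduct_diagonal Z ρ
  constructor
  · refine le_eigenvalue_of_le_form hX hν k
      (Z.submatrix (fun j : {j : Fin d // k < j} => Fin.castLE hd j.1) id) ?_ fun x hx => ?_
    · rw [card_subtype_gt]
      have := k.2
      omega
    · rw [← hM, hf, mul_right_comm]
      calc (K * ∑ j, ‖x j‖ ^ 2) * ρ (Fin.castLE hd k)
          ≤ (∑ j : Fin d, ‖(Z *ᵥ x) (Fin.castLE hd j)‖ ^ 2) * ρ (Fin.castLE hd k) :=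
            mul_le_mul_of_nonneg_right (hK x) (hρ0 _)
        _ ≤ ∑ j : Fin d, ρ (Fin.castLE hd j) * ‖(Z *ᵥ x) (Fin.castLE hd j)‖ ^ 2 := by
            rw [Finset.sum_mul]
            refine Finset.sum_le_sum fun j _ => ?_
            rw [mul_comm]
            rcases le_or_gt j k with hj | hj
            · exact mul_le_mul_of_nonneg_right (hρ (Fin.castLE_le_castLE_iff hd |>.mpr hj))
                (by positivity)
            · have h0 : (Z *ᵥ x) (Fin.castLE hd j) = 0 := congrFun hx ⟨j, hj⟩
              simp [h0]
        _ ≤ ∑ j, ρ j * ‖(Z *ᵥ x) j‖ ^ 2 := by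
            refine (Finset.sum_map Finset.univ (Fin.castLEEmb hd)
              (fun j => ρ j * ‖(Z *ᵥ x) j‖ ^ 2)).symm.trans_le ?_
            exact Finset.sum_le_sum_of_subset_of_nonneg (Finset.subset_univ _)
              fun i _ _ => mul_nonneg (hρ0 i) (by positivity)
  · refine eigenvalue_le_of_form_le hX hν k
      (Z.submatrix (fun j : {j : Fin d // j < k} => Fin.castLE hd j.1) id) ?_ fun x hx => ?_
    · rw [card_subtype_lt]
    · rw [← hM, hf, ← sum_norm_sq_mulVec_of_isometry hZ, Finset.mul_sum]
      refine Finset.sum_le_sum fun j _ => ?_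
      rcases le_or_gt (Fin.castLE hd k) j with hj | hj
      · exact mul_le_mul_of_nonneg_right (hρ hj) (by positivity)
      · have hjk : (j : ℕ) < k := hj
        have h0 : (Z *ᵥ x) j = 0 := congrFun hx ⟨⟨j, hjk.trans k.2⟩, hjk⟩
        simp [h0]

/-- if `A ≥ 0` has eigenvalues `μ_1 ≥ … ≥ μ_n` with orthonormal
eigenvectors `v_j`, and the range of the isometry `V` meets `span{v_j : j > d}`
trivially, then `λ_k((Vᴴ Aᵖ V)^(1/p)) → μ_k` as `p → ∞`, for every `k ≤ d`. -/
theorem kth_eigenvalue_compressed_power_limit {n d : ℕ} (hd : d ≤ n)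
    (A : Matrix (Fin n) (Fin n) ℂ) (hA : A.PosSemidef)
    (μ : Fin n → ℝ) (v : Fin n → Fin n → ℂ)
    (hμ : Antitone μ)
    (hAv : ∀ j, A *ᵥ v j = (μ j : ℂ) • v j)
    (hortho : ∀ i j, star (v i) ⬝ᵥ v j = if i = j then 1 else 0)
    (V : Matrix (Fin n) (Fin d) ℂ) (hV : Vᴴ * V = 1)
    (hrange : Disjoint (LinearMap.range V.mulVecLin)
      (Submodule.span ℂ {x | ∃ j : Fin n, d ≤ (j : ℕ) ∧ v j = x}))
    (k : Fin d) :
    Filter.Tendsto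
      (fun p : ℝ =>
        kthEig (matFun (Vᴴ * matFun A (fun x => x ^ p) * V) (fun x => x ^ (1 / p))) k)
      Filter.atTop (nhds (μ (Fin.castLE hd k))) := by
  let X : Matrix (Fin n) (Fin n) ℂ := (of v)ᵀ
  have hX : Xᴴ * X = 1 := by
    ext i j
    rw [one_apply, ← hortho i j]
    rfl
  have hX' : X * Xᴴ = 1 := mul_eq_one_comm.mp hX
  have hA' : A = X * diagonal (fun i => (μ i : ℂ)) * Xᴴ := by
    have h : A * X = X * diagonal (fun i => (μ i : ℂ)) := by
      ext i j
      rw [mul_diagonal, mul_comm]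
      exact congrFun (hAv j) i
    rw [← h, mul_assoc, hX', mul_one]
  have hμ0 : ∀ j, 0 ≤ μ j := by
    intro j
    have h := hA.dotProduct_mulVec_nonneg (v j)
    rw [hAv, dotProduct_smul, hortho, if_pos rfl, smul_eq_mul, mul_one] at h
    exact_mod_cast h
  let Z : Matrix (Fin n) (Fin d) ℂ := Xᴴ * V
  have hZ : Zᴴ * Z = 1 := by
    rw [conjTranspose_mul, conjTranspose_conjTranspose, Matrix.mul_assoc, ← Matrix.mul_assoc X, hX',
      Matrix.one_mul, hV]
  obtain ⟨K, hK0, hK⟩ := exists_sum_norm_sq_le_of_injective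
    (Z.submatrix (Fin.castLE hd) id) (by
      intro x hx
      have hsum : V *ᵥ x = ∑ j, (Z *ᵥ x) j • v j := by
        have h : V *ᵥ x = X *ᵥ (Z *ᵥ x) := by
          rw [mulVec_mulVec, ← Matrix.mul_assoc, hX', Matrix.one_mul]
        rw [h, mulVec_eq_sum]
        simp only [op_smul_eq_smul]
        rfl
      have hmem : V *ᵥ x ∈ Submodule.span ℂ {x | ∃ j : Fin n, d ≤ (j : ℕ) ∧ v j = x} := by
        rw [hsum]
        refine Submodule.sum_mem _ fun j _ => ?_
        rcases lt_or_ge (j : ℕ) d with hj | hj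
        · have h0 : (Z *ᵥ x) j = 0 := congrFun hx ⟨j, hj⟩
          rw [h0, zero_smul]
          exact Submodule.zero_mem _
        · exact Submodule.smul_mem _ _ (Submodule.subset_span ⟨j, hj, rfl⟩)
      have h0 : V *ᵥ x = 0 := Submodule.disjoint_def.mp hrange _ ⟨x, rfl⟩ hmem
      rw [← one_mulVec x, ← hV, ← mulVec_mulVec, h0, mulVec_zero])
  have hbounds : ∀ p : ℝ, 0 < p →
      K ^ (1 / p) * μ (Fin.castLE hd k) ≤
        kthEig (matFun (Vᴴ * matFun A (fun x => x ^ p) * V) (fun x => x ^ (1 / p))) k ∧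
      kthEig (matFun (Vᴴ * matFun A (fun x => x ^ p) * V) (fun x => x ^ (1 / p))) k ≤
        μ (Fin.castLE hd k) := by
    intro p hp
    have hB : Vᴴ * matFun A (fun x => x ^ p) * V =
        Zᴴ * diagonal (fun i => ((μ i ^ p : ℝ) : ℂ)) * Z := by
      rw [hA', matFun_eq_of_diagonalization hX]
      simp only [Z, conjTranspose_mul, conjTranspose_conjTranspose, Matrix.mul_assoc]
    have hBh : (Zᴴ * diagonal (fun i => ((μ i ^ p : ℝ) : ℂ)) * Z).IsHermitian := by
      simpa using isHermitian_unitary_diagonal Zᴴ (fun i => μ i ^ p)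
    obtain ⟨Y, ν, hY, hν, hM, -⟩ := exists_antitone_diagonalization hBh
    have hb := kthEig_compression_bounds hd hZ hK
      (fun i j hij => Real.rpow_le_rpow (hμ0 j) (hμ hij) hp.le)
      (fun i => Real.rpow_nonneg (hμ0 i) p) hY hν hM
    have hν0 : ∀ j, 0 ≤ ν j := fun j =>
      (mul_nonneg hK0.le (Real.rpow_nonneg (hμ0 _) p)).trans (hb j).1
    have hp' : 0 ≤ 1 / p := by positivity
    have hroot : (μ (Fin.castLE hd k) ^ p) ^ (1 / p) = μ (Fin.castLE hd k) := by
      rw [one_div, Real.rpow_rpow_inv (hμ0 _) hp.ne']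
    rw [hB, hM, matFun_eq_of_diagonalization hY, kthEig_eq_of_diagonalization hY
      (fun i j hij => Real.rpow_le_rpow (hν0 j) (hν hij) hp')]
    constructor
    · have h := Real.rpow_le_rpow
        (mul_nonneg hK0.le (Real.rpow_nonneg (hμ0 _) p)) (hb k).1 hp'
      rwa [Real.mul_rpow hK0.le (Real.rpow_nonneg (hμ0 _) p), hroot] at h
    · have h := Real.rpow_le_rpow (hν0 k) (hb k).2 hp'
      rwa [hroot] at h
  have hlim : Filter.Tendsto (fun p : ℝ => K ^ (1 / p) * μ (Fin.castLE hd k)) Filter.atTop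
      (nhds (μ (Fin.castLE hd k))) := by
    have h0 : Filter.Tendsto (fun p : ℝ => 1 / p) Filter.atTop (nhds 0) := by
      simpa using tendsto_inv_atTop_zero (𝕜 := ℝ)
    have h1 := (tendsto_const_nhds (x := K)).rpow h0 (Or.inl hK0.ne')
    simpa using h1.mul_const (μ (Fin.castLE hd k))
  refine tendsto_of_tendsto_of_tendsto_of_le_of_le' hlim tendsto_const_nhds ?_ ?_
  · filter_upwards [Filter.eventually_gt_atTop 0] with p hp using (hbounds p hp).1
  · filter_upwards [Filter.eventually_gt_atTop 0] with p hp using (hbounds p hp).2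
end

section
/- Let A be a positive semidefinite n×n complex matrix and let V be an n×d complex matrix with V*V = I_d. Then the map p ↦ (V* A^p V)^{1/p} is nondecreasing for the Loewner order on [1,∞): for all 1 ≤ p ≤ q, (V* A^p V)^{1/p} ≤ (V* A^q V)^{1/q}. -/
open Matrix ComplexOrder

section CompressedPowers

open scoped MatrixOrder Matrix.Norms.L2Operator

variable {m n : ℕ}

/-- A matrix intertwining two Hermitian matrices intertwines their functional calculi. -/
lemma matFun_mul_eq_mul_matFun {A : Matrix (Fin m) (Fin m) ℂ} {B : Matrix (Fin n) (Fin n) ℂ}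
    (hA : A.IsHermitian) (hB : B.IsHermitian) {V : Matrix (Fin m) (Fin n) ℂ}
    (h : A * V = V * B) (f : ℝ → ℝ) : matFun A f * V = V * matFun B f := by
  have hUA : (hA.eigenvectorUnitary : Matrix (Fin m) (Fin m) ℂ) *
      star (hA.eigenvectorUnitary : Matrix (Fin m) (Fin m) ℂ) = 1 := Unitary.coe_mul_star_self _
  have hUA' : star (hA.eigenvectorUnitary : Matrix (Fin m) (Fin m) ℂ) *
      (hA.eigenvectorUnitary : Matrix (Fin m) (Fin m) ℂ) = 1 := Unitary.coe_star_mul_self _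
  have hUB : (hB.eigenvectorUnitary : Matrix (Fin n) (Fin n) ℂ) *
      star (hB.eigenvectorUnitary : Matrix (Fin n) (Fin n) ℂ) = 1 := Unitary.coe_mul_star_self _
  have hUB' : star (hB.eigenvectorUnitary : Matrix (Fin n) (Fin n) ℂ) *
      (hB.eigenvectorUnitary : Matrix (Fin n) (Fin n) ℂ) = 1 := Unitary.coe_star_mul_self _
  have hA' := hA.spectral_theorem
  have hB' := hB.spectral_theorem
  rw [Unitary.conjStarAlgAut_apply] at hA' hB'
  simp only [matFun, hA, hB, dif_pos]
  generalize (hA.eigenvectorUnitary : Matrix (Fin m) (Fin m) ℂ) = P at *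
  generalize (hB.eigenvectorUnitary : Matrix (Fin n) (Fin n) ℂ) = Q at *
  have key : diagonal (fun i => (hA.eigenvalues i : ℂ)) * (star P * V * Q) =
      (star P * V * Q) * diagonal (fun i => (hB.eigenvalues i : ℂ)) := by
    calc _ = (star P * P) * diagonal (fun i => (hA.eigenvalues i : ℂ)) * star P * V * Q := by
          simp only [hUA', one_mul, Matrix.mul_assoc]
      _ = star P * (A * V) * Q := by
          conv_rhs => rw [hA']
          simp only [Matrix.mul_assoc]; rfl
      _ = star P * V * Q * diagonal (fun i => (hB.eigenvalues i : ℂ)) * (star Q * Q) := by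
          rw [h]
          conv_lhs => rw [hB']
          simp only [Matrix.mul_assoc]; rfl
      _ = _ := by rw [hUB', Matrix.mul_one]
  have key' : diagonal (fun i => (f (hA.eigenvalues i) : ℂ)) * (star P * V * Q) =
      (star P * V * Q) * diagonal (fun i => (f (hB.eigenvalues i) : ℂ)) := by
    ext i j
    have hij := congrFun (congrFun key i) j
    rw [diagonal_mul, mul_diagonal, mul_comm, mul_eq_mul_left_iff] at hij
    rw [diagonal_mul, mul_diagonal, mul_comm]
    rcases hij with hij | hij
    · rw [Complex.ofReal_inj.mp hij]
    · rw [hij, zero_mul, zero_mul]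
  calc _ = P * (diagonal (fun i => (f (hA.eigenvalues i) : ℂ)) * (star P * V * Q)) * star Q := by
        simp only [Matrix.mul_assoc, hUB, Matrix.mul_one]
    _ = (P * star P) * V * (Q * diagonal (fun i => (f (hB.eigenvalues i) : ℂ)) * star Q) := by
        rw [key']; simp only [Matrix.mul_assoc]
    _ = _ := by rw [hUA, Matrix.one_mul]

lemma matFun_rpow {A : Matrix (Fin n) (Fin n) ℂ} (hA : 0 ≤ A) (p : ℝ) :
    matFun A (fun x => x ^ p) = A ^ p := by
  have hH : A.IsHermitian := (Matrix.nonneg_iff_posSemidef.mp hA).isHermitian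
  rw [CFC.rpow_eq_cfc_real hA, hH.cfc_eq, Matrix.IsHermitian.cfc, Unitary.conjStarAlgAut_apply,
    matFun, dif_pos hH]
  rfl

lemma rpow_mul_eq_mul_rpow {A : Matrix (Fin m) (Fin m) ℂ} {B : Matrix (Fin n) (Fin n) ℂ}
    (hA : 0 ≤ A) (hB : 0 ≤ B) {V : Matrix (Fin m) (Fin n) ℂ}
    (h : A * V = V * B) (p : ℝ) : A ^ p * V = V * B ^ p := by
  rw [← matFun_rpow hA, ← matFun_rpow hB]
  exact matFun_mul_eq_mul_matFun (Matrix.nonneg_iff_posSemidef.mp hA).isHermitian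
    (Matrix.nonneg_iff_posSemidef.mp hB).isHermitian h _

lemma compression_nonneg {B : Matrix (Fin m) (Fin m) ℂ} (hB : 0 ≤ B)
    (V : Matrix (Fin m) (Fin n) ℂ) : 0 ≤ Vᴴ * B * V :=
  Matrix.nonneg_iff_posSemidef.mpr
    ((Matrix.nonneg_iff_posSemidef.mp hB).conjTranspose_mul_mul_same V)

lemma compression_mono {B C : Matrix (Fin m) (Fin m) ℂ} (h : B ≤ C)
    (V : Matrix (Fin m) (Fin n) ℂ) : Vᴴ * B * V ≤ Vᴴ * C * V := by
  rw [← sub_nonneg, ← Matrix.sub_mul, ← Matrix.mul_sub]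
  exact compression_nonneg (sub_nonneg.mpr h) V

/-- The operator Jensen inequality for the concave powers, under compression by an isometry. -/
lemma compression_rpow_le_rpow_compression {B : Matrix (Fin m) (Fin m) ℂ} (hB : 0 ≤ B)
    {V : Matrix (Fin m) (Fin n) ℂ} (hV : Vᴴ * V = 1) {s : ℝ} (hs : s ∈ Set.Icc 0 1) :
    Vᴴ * B ^ s * V ≤ (Vᴴ * B * V) ^ s := by
  -- `U` is the reflection fixing the range of `V`.
  set U : Matrix (Fin m) (Fin m) ℂ := (2 : ℝ) • (V * Vᴴ) - 1 with hU
  have hUV : U * V = V := by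
    rw [hU, Matrix.sub_mul, Matrix.smul_mul, Matrix.mul_assoc, hV, two_smul]
    simp
  have hUH : Uᴴ = U := by
    simp [hU, Matrix.conjTranspose_smul]
  have hVU : Vᴴ * U = Vᴴ := by
    rw [← hUH, ← Matrix.conjTranspose_mul, hUV]
  have hUU : U * U = 1 := by
    nth_rewrite 2 [hU]
    rw [Matrix.mul_sub, Matrix.mul_smul, ← Matrix.mul_assoc, hUV, hU]
    simp
  have hB' : 0 ≤ U * B * U := by
    simpa only [hUH] using compression_nonneg hB U
  have hpow : (U * B * U) ^ s = U * B ^ s * U := by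
    have h : (U * B * U) * U = U * B := by rw [Matrix.mul_assoc, hUU, Matrix.mul_one]
    rw [← rpow_mul_eq_mul_rpow hB' hB h, Matrix.mul_assoc (_ ^ s), hUU, Matrix.mul_one]
  have hhalf : (0 : ℝ) ≤ 1 / 2 := by norm_num
  have hconc := (CFC.concaveOn_rpow (A := Matrix (Fin m) (Fin m) ℂ) hs).2
    (Set.mem_Ici.mpr hB) (Set.mem_Ici.mpr hB') hhalf hhalf (by norm_num)
  set C : Matrix (Fin m) (Fin m) ℂ := (1 / 2 : ℝ) • B + (1 / 2 : ℝ) • (U * B * U) with hC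
  have hC0 : 0 ≤ C := add_nonneg (smul_nonneg hhalf hB) (smul_nonneg hhalf hB')
  have hCV : C * V = V * (Vᴴ * B * V) := by
    have h1 : U * B * U * V = (2 : ℝ) • (V * (Vᴴ * B * V)) - B * V := by
      rw [Matrix.mul_assoc, hUV, hU]
      simp only [Matrix.sub_mul, Matrix.smul_mul, Matrix.mul_assoc, Matrix.one_mul]
    rw [hC, Matrix.add_mul, Matrix.smul_mul, Matrix.smul_mul, h1]
    module
  calc Vᴴ * B ^ s * V
      = Vᴴ * ((1 / 2 : ℝ) • B ^ s + (1 / 2 : ℝ) • (U * B * U) ^ s) * V := by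
        have h2 : Vᴴ * (U * B ^ s * U) * V = Vᴴ * B ^ s * V := by
          rw [Matrix.mul_assoc, Matrix.mul_assoc, hUV, ← Matrix.mul_assoc, ← Matrix.mul_assoc, hVU]
        rw [hpow, Matrix.mul_add, Matrix.add_mul, Matrix.mul_smul, Matrix.mul_smul,
          Matrix.smul_mul, Matrix.smul_mul, h2]
        module
    _ ≤ Vᴴ * C ^ s * V := compression_mono hconc V
    _ = (Vᴴ * B * V) ^ s := by
        rw [Matrix.mul_assoc, rpow_mul_eq_mul_rpow hC0 (compression_nonneg hB V) hCV,
          ← Matrix.mul_assoc, hV, Matrix.one_mul]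

lemma compression_rpow_rpow_inv_mono {A : Matrix (Fin m) (Fin m) ℂ} (hA : 0 ≤ A)
    {V : Matrix (Fin m) (Fin n) ℂ} (hV : Vᴴ * V = 1) {p q : ℝ} (hp : 1 ≤ p) (hpq : p ≤ q) :
    (Vᴴ * A ^ p * V) ^ (1 / p) ≤ (Vᴴ * A ^ q * V) ^ (1 / q) := by
  have hp0 : 0 < p := by linarith
  have hq0 : 0 < q := by linarith
  have hs : p / q ∈ Set.Icc (0 : ℝ) 1 := ⟨by positivity, (div_le_one hq0).mpr hpq⟩
  have hinv : 1 / p ∈ Set.Icc (0 : ℝ) 1 := ⟨by positivity, (div_le_one hp0).mpr hp⟩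
  have hAq : (0 : Matrix (Fin m) (Fin m) ℂ) ≤ A ^ q := CFC.rpow_nonneg
  have hjensen := compression_rpow_le_rpow_compression hAq hV hs
  rw [CFC.rpow_rpow_of_exponent_nonneg A _ _ hq0.le hs.1 hA, mul_div_cancel₀ _ hq0.ne'] at hjensen
  refine (CFC.rpow_le_rpow hinv hjensen).trans_eq ?_
  rw [CFC.rpow_rpow_of_exponent_nonneg _ _ _ hs.1 hinv.1 (compression_nonneg hAq V)]
  congr 1
  field_simp

lemma posSemidef_matFun_compression_sub {A : Matrix (Fin m) (Fin m) ℂ} (hA : 0 ≤ A)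
    {V : Matrix (Fin m) (Fin n) ℂ} (hV : Vᴴ * V = 1) {p q : ℝ} (hp : 1 ≤ p) (hpq : p ≤ q) :
    (matFun (Vᴴ * matFun A (fun x => x ^ q) * V) (fun x => x ^ (1 / q)) -
      matFun (Vᴴ * matFun A (fun x => x ^ p) * V) (fun x => x ^ (1 / p))).PosSemidef := by
  rw [matFun_rpow hA, matFun_rpow hA, matFun_rpow (compression_nonneg CFC.rpow_nonneg V),
    matFun_rpow (compression_nonneg CFC.rpow_nonneg V)]
  exact Matrix.le_iff.mp (compression_rpow_rpow_inv_mono hA hV hp hpq)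

end CompressedPowers

/-- for a positive semidefinite `A` and an isometry `V`, the map
`p ↦ (Vᴴ Aᵖ V)^(1/p)` is nondecreasing for the Loewner order on `[1,∞)`. -/
theorem compressed_power_loewner_monotone {n d : ℕ}
    (A : Matrix (Fin n) (Fin n) ℂ) (hA : A.PosSemidef)
    (V : Matrix (Fin n) (Fin d) ℂ) (hV : Vᴴ * V = 1) :
    ∀ p q : ℝ, 1 ≤ p → p ≤ q →
      (matFun (Vᴴ * matFun A (fun x => x ^ q) * V) (fun x => x ^ (1 / q)) -
        matFun (Vᴴ * matFun A (fun x => x ^ p) * V) (fun x => x ^ (1 / p))).PosSemidef := by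
  exact fun p q hp hpq =>
    posSemidef_matFun_compression_sub (Matrix.nonneg_iff_posSemidef.mpr hA) hV hp hpq
end

section
/- Let f be a monotone (nondecreasing or nonincreasing) convex real function defined on an interval [a,b], let A_1, …, A_m be n×n Hermitian complex matrices whose spectra lie in [a,b], and let Z_1, …, Z_m be n×n complex matrices forming an isometric column, i.e. Σ_{i=1}^m Z_i* Z_i = I. Then there exists an n×n unitary matrix U such that f(Σ_i Z_i* A_i Z_i) ≤ U (Σ_i Z_i* f(A_i) Z_i) U* in the Loewner order. -/
open Matrix ComplexOrder

/-- If every superlevel set of `p` is at most as large as that of `q`, then some permutation of `q`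
dominates `p`. -/
theorem exists_perm_le_of_card_superlevel_le {ι : Type*} [Fintype ι] (p q : ι → ℝ)
    (h : ∀ t : ℝ, (Finset.univ.filter fun i => t ≤ p i).card ≤
      (Finset.univ.filter fun j => t ≤ q j).card) :
    ∃ σ : Equiv.Perm ι, ∀ i, p i ≤ q (σ i) := by
  classical
  obtain ⟨g, hg, hle⟩ := (Finset.all_card_le_biUnion_card_iff_exists_injective
    (fun i => Finset.univ.filter fun j => p i ≤ q j)).1 (fun s => by
      rcases s.eq_empty_or_nonempty with rfl | hs
      · simp
      · obtain ⟨i₀, hi₀, hmin⟩ := s.exists_min_image p hs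
        calc s.card ≤ (Finset.univ.filter fun i => p i₀ ≤ p i).card :=
              Finset.card_le_card fun i hi => by simpa using hmin i hi
          _ ≤ (Finset.univ.filter fun j => p i₀ ≤ q j).card := h _
          _ ≤ _ := Finset.card_le_card
              (Finset.subset_biUnion_of_mem (fun i => Finset.univ.filter fun j => p i ≤ q j) hi₀))
  exact ⟨Equiv.ofBijective g (Finite.injective_iff_bijective.1 hg),
    fun i => by simpa using hle i⟩

/-- Two families of coordinate functionals with fewer members than the dimension have a common
nonzero zero. -/
theorem exists_ne_zero_forall_mulVec_eq_zero {ι : Type*} [Fintype ι] (M N : Matrix ι ι ℂ)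
    (s t : Finset ι) (h : s.card + t.card < Fintype.card ι) :
    ∃ x : ι → ℂ, x ≠ 0 ∧ (∀ i ∈ s, (M *ᵥ x) i = 0) ∧ ∀ i ∈ t, (N *ᵥ x) i = 0 := by
  let L : (ι → ℂ) →ₗ[ℂ] ((s → ℂ) × (t → ℂ)) :=
    ((LinearMap.funLeft ℂ ℂ (Subtype.val : s → ι)).comp M.mulVecLin).prod
      ((LinearMap.funLeft ℂ ℂ (Subtype.val : t → ι)).comp N.mulVecLin)
  have hL : LinearMap.ker L ≠ ⊥ := LinearMap.ker_ne_bot_of_finrank_lt (by simpa using h)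
  obtain ⟨x, hx, hx0⟩ := Submodule.exists_mem_ne_zero_of_ne_bot hL
  have hx' := Prod.ext_iff.1 (LinearMap.mem_ker.1 hx)
  exact ⟨x, hx0, fun i hi => congrFun hx'.1 ⟨i, hi⟩, fun i hi => congrFun hx'.2 ⟨i, hi⟩⟩

/-- The quadratic form of a unitarily diagonalized matrix. -/
theorem star_dotProduct_mul_diagonal_mul_star_mulVec {ι : Type*} [Fintype ι] [DecidableEq ι]
    (V : Matrix ι ι ℂ) (d : ι → ℝ) (x : ι → ℂ) :
    star x ⬝ᵥ ((V * diagonal (fun i => (d i : ℂ)) * star V) *ᵥ x) =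
      ((∑ i, Complex.normSq ((star V *ᵥ x) i) * d i : ℝ) : ℂ) := by
  have hV : star x ᵥ* V = star (star V *ᵥ x) := by
    rw [star_mulVec, star_eq_conjTranspose, conjTranspose_conjTranspose]
  rw [← mulVec_mulVec, ← mulVec_mulVec, dotProduct_mulVec, hV, dotProduct]
  push_cast
  refine Finset.sum_congr rfl fun i _ => ?_
  rw [mulVec_diagonal, Complex.normSq_eq_conj_mul_self, Pi.star_apply]
  simp only [RCLike.star_def]
  ring

theorem sum_normSq_star_mulVec {ι : Type*} [Fintype ι] [DecidableEq ι]
    {V : Matrix ι ι ℂ} (hV : V * star V = 1) (x : ι → ℂ) :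
    ((∑ i, Complex.normSq ((star V *ᵥ x) i) : ℝ) : ℂ) = star x ⬝ᵥ x := by
  have h := star_dotProduct_mul_diagonal_mul_star_mulVec V (fun _ => 1) x
  simpa [hV] using h.symm

theorem Matrix.IsHermitian.eq_mul_diagonal_mul_star {ι : Type*} [Fintype ι] [DecidableEq ι]
    {A : Matrix ι ι ℂ} (hA : A.IsHermitian) :
    A = (hA.eigenvectorUnitary : Matrix ι ι ℂ) * diagonal (fun i => (hA.eigenvalues i : ℂ)) *
      star (hA.eigenvectorUnitary : Matrix ι ι ℂ) := by
  conv_lhs => rw [hA.spectral_theorem, Unitary.conjStarAlgAut_apply]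
  rfl

theorem isHermitian_mul_diagonal_mul_star {ι : Type*} [Fintype ι] [DecidableEq ι]
    (V : Matrix ι ι ℂ) (d : ι → ℝ) :
    (V * diagonal (fun i => (d i : ℂ)) * star V).IsHermitian :=
  isHermitian_mul_mul_conjTranspose V (isHermitian_diagonal_of_self_adjoint _ (by
    ext i; simp))

theorem matFun_eq {n : ℕ} {A : Matrix (Fin n) (Fin n) ℂ} (hA : A.IsHermitian) (f : ℝ → ℝ) :
    matFun A f = (hA.eigenvectorUnitary : Matrix (Fin n) (Fin n) ℂ) *
      diagonal (fun i => (f (hA.eigenvalues i) : ℂ)) *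
      star (hA.eigenvectorUnitary : Matrix (Fin n) (Fin n) ℂ) :=
  dif_pos hA

theorem matFun_id_s5 {n : ℕ} {A : Matrix (Fin n) (Fin n) ℂ} (hA : A.IsHermitian) :
    matFun A (fun r => r) = A := by
  rw [matFun_eq hA]
  exact hA.eq_mul_diagonal_mul_star.symm

theorem matFun_one {n : ℕ} {A : Matrix (Fin n) (Fin n) ℂ} (hA : A.IsHermitian) :
    matFun A (fun _ => 1) = 1 := by
  simp [matFun_eq hA]

/-- The weights with which the eigenvalues of the `A i` enter the quadratic form of
`∑ i, (Z i)ᴴ * A i * Z i` at `x`. -/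
noncomputable def columnWeight {n m : ℕ} {A : Fin m → Matrix (Fin n) (Fin n) ℂ}
    (hA : ∀ i, (A i).IsHermitian) (Z : Fin m → Matrix (Fin n) (Fin n) ℂ) (x : Fin n → ℂ)
    (k : Fin m × Fin n) : ℝ :=
  Complex.normSq
    ((star ((hA k.1).eigenvectorUnitary : Matrix (Fin n) (Fin n) ℂ) *ᵥ (Z k.1 *ᵥ x)) k.2)

theorem star_dotProduct_sum_matFun_mulVec {n m : ℕ} {A : Fin m → Matrix (Fin n) (Fin n) ℂ}
    (hA : ∀ i, (A i).IsHermitian) (Z : Fin m → Matrix (Fin n) (Fin n) ℂ) (x : Fin n → ℂ)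
    (g : ℝ → ℝ) :
    star x ⬝ᵥ ((∑ i, (Z i)ᴴ * matFun (A i) g * Z i) *ᵥ x) =
      ((∑ k, columnWeight hA Z x k * g ((hA k.1).eigenvalues k.2) : ℝ) : ℂ) := by
  rw [Fintype.sum_prod_type, sum_mulVec, dotProduct_sum, Complex.ofReal_sum]
  refine Finset.sum_congr rfl fun i _ => ?_
  rw [← mulVec_mulVec, ← mulVec_mulVec, dotProduct_mulVec, ← star_mulVec, matFun_eq (hA i)]
  exact star_dotProduct_mul_diagonal_mul_star_mulVec _
    (fun j => g ((hA i).eigenvalues j)) (Z i *ᵥ x)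

/-- **Jensen's inequality** for isometric columns: if `x ≠ 0` has squared norm `N`, the quadratic
form of `∑ i, (Z i)ᴴ * A i * Z i` at `x` is `N * y` with `y ∈ s`, and that of
`∑ i, (Z i)ᴴ * f (A i) * Z i` is at least `N * f y`. -/
theorem ConvexOn.exists_le_sum_matFun {n m : ℕ} {s : Set ℝ} {f : ℝ → ℝ} (hf : ConvexOn ℝ s f)
    {A : Fin m → Matrix (Fin n) (Fin n) ℂ} (hA : ∀ i, (A i).IsHermitian)
    (hspec : ∀ i j, (hA i).eigenvalues j ∈ s)
    {Z : Fin m → Matrix (Fin n) (Fin n) ℂ} (hZ : ∑ i, (Z i)ᴴ * Z i = 1)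
    {x : Fin n → ℂ} {N : ℝ} (hN : 0 < N) (hx : star x ⬝ᵥ x = (N : ℂ)) :
    ∃ y ∈ s, star x ⬝ᵥ ((∑ i, (Z i)ᴴ * A i * Z i) *ᵥ x) = ((N * y : ℝ) : ℂ) ∧
      ∃ z : ℝ, star x ⬝ᵥ ((∑ i, (Z i)ᴴ * matFun (A i) f * Z i) *ᵥ x) = (z : ℂ) ∧
        N * f y ≤ z := by
  have hw0 : ∀ k ∈ Finset.univ, 0 ≤ columnWeight hA Z x k := fun k _ => Complex.normSq_nonneg _
  have hsum : ∑ k, columnWeight hA Z x k = N := by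
    have h := star_dotProduct_sum_matFun_mulVec hA Z x (fun _ => 1)
    simp only [matFun_one (hA _), mul_one, hZ, one_mulVec, hx] at h
    exact_mod_cast h.symm
  have hid := star_dotProduct_sum_matFun_mulVec hA Z x (fun r => r)
  simp only [matFun_id_s5 (hA _)] at hid
  have hmem : ∀ k ∈ (Finset.univ : Finset (Fin m × Fin n)), (hA k.1).eigenvalues k.2 ∈ s :=
    fun k _ => hspec _ _
  refine ⟨Finset.univ.centerMass (columnWeight hA Z x) (fun k => (hA k.1).eigenvalues k.2),
    hf.1.centerMass_mem hw0 (hsum ▸ hN) hmem, ?_, _, star_dotProduct_sum_matFun_mulVec hA Z x f, ?_⟩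
  · rw [hid, Finset.centerMass, hsum, smul_eq_mul, mul_inv_cancel_left₀ hN.ne']
    simp only [smul_eq_mul]
  · have h := hf.map_centerMass_le hw0 (hsum ▸ hN) hmem
    refine (mul_le_mul_of_nonneg_left h hN.le).trans_eq ?_
    rw [Finset.centerMass, hsum, smul_eq_mul, mul_inv_cancel_left₀ hN.ne']
    simp only [smul_eq_mul, Function.comp_apply]

theorem exists_pos_star_dotProduct_self {ι : Type*} [Fintype ι] {x : ι → ℂ} (hx : x ≠ 0) :
    ∃ N : ℝ, 0 < N ∧ star x ⬝ᵥ x = (N : ℂ) := by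
  have h : 0 < star x ⬝ᵥ x := dotProduct_star_self_pos_iff.2 hx
  exact ⟨(star x ⬝ᵥ x).re, (Complex.pos_iff.1 h).1,
    Complex.ext rfl (Complex.pos_iff.1 h).2.symm⟩

/-- A real diagonalized matrix dominates, up to unitary conjugation, any other one whose
eigenvalues can be matched below its own. -/
theorem exists_unitary_conj_sub_posSemidef {ι : Type*} [Fintype ι] [DecidableEq ι]
    {V W : Matrix ι ι ℂ} (hV : V * star V = 1) (hW : star W * W = 1) (p q : ι → ℝ)
    (σ : Equiv.Perm ι) (h : ∀ i, p i ≤ q (σ i)) :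
    ∃ U : Matrix ι ι ℂ, Uᴴ * U = 1 ∧
      (U * (W * diagonal (fun i => (q i : ℂ)) * star W) * Uᴴ -
        V * diagonal (fun i => (p i : ℂ)) * star V).PosSemidef := by
  set W' := W.submatrix id σ with hW'
  have hstar : star W' = (star W).submatrix σ id := rfl
  have h1 : star W' * W' = 1 := by
    rw [hstar, hW', ← submatrix_mul _ _ _ _ _ Function.bijective_id, hW, submatrix_one_equiv]
  have h2 : W * diagonal (fun i => (q i : ℂ)) * star W =
      W' * diagonal (fun i => (q (σ i) : ℂ)) * star W' := by
    have hd : diagonal (fun i => (q (σ i) : ℂ)) =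
        (diagonal (fun i => (q i : ℂ))).submatrix σ σ :=
      (submatrix_diagonal_equiv (fun i => (q i : ℂ)) σ).symm
    rw [hd, hstar, hW', submatrix_mul_equiv, submatrix_mul_equiv, submatrix_id_id]
  have h3 : star V * V = 1 := mul_eq_one_comm.1 hV
  have hU : (V * star W')ᴴ = W' * star V := by
    rw [← star_eq_conjTranspose, star_mul, star_star]
  refine ⟨V * star W', ?_, ?_⟩
  · calc (V * star W')ᴴ * (V * star W') = W' * (star V * V) * star W' := by
          rw [hU]; simp only [mul_assoc]
      _ = 1 := by rw [h3, mul_one]; exact mul_eq_one_comm.1 h1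
  · have h4 : V * star W' * (W * diagonal (fun i => (q i : ℂ)) * star W) * (V * star W')ᴴ -
        V * diagonal (fun i => (p i : ℂ)) * star V =
        V * diagonal (fun i => ((q (σ i) - p i : ℝ) : ℂ)) * Vᴴ := by
      calc _ = V * (star W' * W') * diagonal (fun i => (q (σ i) : ℂ)) * (star W' * W') * star V -
            V * diagonal (fun i => (p i : ℂ)) * star V := by
            rw [hU, h2]; simp only [mul_assoc]
        _ = _ := by
            rw [h1, mul_one, mul_one, ← sub_mul, ← mul_sub, diagonal_sub, star_eq_conjTranspose]
            simp only [Complex.ofReal_sub]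
    rw [h4]
    refine PosSemidef.mul_mul_conjTranspose_same (posSemidef_diagonal_iff.2 fun i => ?_) V
    exact Complex.zero_le_real.2 (sub_nonneg.2 (h i))

/-- for a monotone convex `f` on `[a,b]`, Hermitian matrices `A_i` with
spectra in `[a,b]`, and an isometric column `{Z_i}` (`Σ Z_iᴴ Z_i = 1`), there is a
unitary `U` with `f(Σ Z_iᴴ A_i Z_i) ≤ U (Σ Z_iᴴ f(A_i) Z_i) Uᴴ`. -/
theorem isometric_column_monotone_convex {n m : ℕ} {a b : ℝ} {f : ℝ → ℝ}
    (hconv : ConvexOn ℝ (Set.Icc a b) f)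
    (hmono : MonotoneOn f (Set.Icc a b) ∨ AntitoneOn f (Set.Icc a b))
    (A : Fin m → Matrix (Fin n) (Fin n) ℂ) (hA : ∀ i, (A i).IsHermitian)
    (hspec : ∀ i j, (hA i).eigenvalues j ∈ Set.Icc a b)
    (Z : Fin m → Matrix (Fin n) (Fin n) ℂ) (hZ : ∑ i, (Z i)ᴴ * Z i = 1) :
    ∃ U : Matrix (Fin n) (Fin n) ℂ, Uᴴ * U = 1 ∧
      (U * (∑ i, (Z i)ᴴ * matFun (A i) f * Z i) * Uᴴ -
        matFun (∑ i, (Z i)ᴴ * A i * Z i) f).PosSemidef := by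
  have hB : (∑ i, (Z i)ᴴ * A i * Z i).IsHermitian :=
    isSelfAdjoint_sum _ fun i _ => isHermitian_conjTranspose_mul_mul (Z i) (hA i)
  have hH : (∑ i, (Z i)ᴴ * matFun (A i) f * Z i).IsHermitian :=
    isSelfAdjoint_sum _ fun i _ => isHermitian_conjTranspose_mul_mul (Z i) (by
      rw [matFun_eq (hA i)]
      exact isHermitian_mul_diagonal_mul_star _ fun j => f ((hA i).eigenvalues j))
  have hquasi : QuasiconcaveOn ℝ (Set.Icc a b) f :=
    hmono.elim (fun h => h.quasiconcaveOn (convex_Icc a b))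
      fun h => h.quasiconcaveOn (convex_Icc a b)
  set μ := hB.eigenvalues with hμ
  set ν := hH.eigenvalues with hν
  set V := (hB.eigenvectorUnitary : Matrix (Fin n) (Fin n) ℂ) with hVdef
  set W := (hH.eigenvectorUnitary : Matrix (Fin n) (Fin n) ℂ) with hWdef
  have hV : V * star V = 1 := Unitary.coe_mul_star_self hB.eigenvectorUnitary
  have hW : star W * W = 1 := Unitary.coe_star_mul_self hH.eigenvectorUnitary
  have hBV := hB.eq_mul_diagonal_mul_star
  have hHW := hH.eq_mul_diagonal_mul_star
  rw [← hμ, ← hVdef] at hBV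
  rw [← hν, ← hWdef] at hHW
  have hμmem : ∀ i, μ i ∈ Set.Icc a b := fun i => by
    set v : Fin n → ℂ := ⇑(hB.eigenvectorBasis i) with hv
    have hvv : star v ⬝ᵥ v = ((1 : ℝ) : ℂ) := by
      rw [dotProduct_comm, ← EuclideanSpace.inner_eq_star_dotProduct]
      simp
    obtain ⟨y, hy, hBy, -⟩ := hconv.exists_le_sum_matFun hA hspec hZ one_pos hvv
    have h := hB.eigenvalues_eq i
    rw [← hv, hBy] at h
    have h' : μ i = y := by simpa using h
    exact h' ▸ hy
  have hcard : ∀ t : ℝ, (Finset.univ.filter fun i => t ≤ f (μ i)).card ≤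
      (Finset.univ.filter fun j => t ≤ ν j).card := fun t => by
    by_contra! hlt
    have hcompl := Finset.card_filter_add_card_filter_not (s := Finset.univ) fun i => t ≤ f (μ i)
    obtain ⟨x, hx0, hxV, hxW⟩ := exists_ne_zero_forall_mulVec_eq_zero (star V) (star W)
      (Finset.univ.filter fun i => ¬ t ≤ f (μ i)) (Finset.univ.filter fun j => t ≤ ν j)
      (by rw [Finset.card_univ] at hcompl; omega)
    obtain ⟨N, hN, hxN⟩ := exists_pos_star_dotProduct_self hx0
    obtain ⟨y, -, hBy, z, hHz, hz⟩ := hconv.exists_le_sum_matFun hA hspec hZ hN hxN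
    have hNV : ∑ i, Complex.normSq ((star V *ᵥ x) i) = N := by
      exact_mod_cast (sum_normSq_star_mulVec hV x).trans hxN
    have hNW : ∑ i, Complex.normSq ((star W *ᵥ x) i) = N := by
      exact_mod_cast (sum_normSq_star_mulVec (mul_eq_one_comm.1 hW) x).trans hxN
    have hty : t ≤ f y := by
      have hyV : y = Finset.univ.centerMass (fun i => Complex.normSq ((star V *ᵥ x) i)) μ := by
        rw [hBV, star_dotProduct_mul_diagonal_mul_star_mulVec] at hBy
        rw [Finset.centerMass, hNV]
        simp only [smul_eq_mul]
        rw [Complex.ofReal_inj.1 hBy, inv_mul_cancel_left₀ hN.ne']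
      rw [hyV, ← Finset.centerMass_filter_ne_zero]
      refine ((hquasi t).centerMass_mem (fun i _ => Complex.normSq_nonneg _) ?_ ?_).2
      · rw [Finset.sum_filter_ne_zero, hNV]
        exact hN
      · intro i hi
        refine ⟨hμmem i, ?_⟩
        by_contra hti
        exact (Finset.mem_filter.1 hi).2 (by rw [hxV i (by simpa using hti), map_zero])
    have hzt : z < N * t := by
      rw [hHW, star_dotProduct_mul_diagonal_mul_star_mulVec] at hHz
      rw [← Complex.ofReal_inj.1 hHz, ← hNW, Finset.sum_mul]
      have hle : ∀ j, t ≤ ν j → Complex.normSq ((star W *ᵥ x) j) = 0 := fun j hj => by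
        rw [hxW j (by simpa using hj), map_zero]
      obtain ⟨j, -, hj⟩ := Finset.exists_ne_zero_of_sum_ne_zero (hNW.trans_ne hN.ne')
      refine Finset.sum_lt_sum (fun j _ => ?_) ⟨j, Finset.mem_univ j, ?_⟩
      · rcases le_or_gt t (ν j) with h | h
        · simp [hle j h]
        · exact mul_le_mul_of_nonneg_left h.le (Complex.normSq_nonneg _)
      · exact mul_lt_mul_of_pos_left (not_le.1 fun h => hj (hle j h))
          ((Complex.normSq_nonneg _).lt_of_ne' hj)
    exact absurd (hz.trans_lt hzt) (not_lt.2 (mul_le_mul_of_nonneg_left hty hN.le))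
  obtain ⟨σ, hσ⟩ := exists_perm_le_of_card_superlevel_le (fun i => f (μ i)) ν hcard
  obtain ⟨U, hU, hpos⟩ := exists_unitary_conj_sub_posSemidef hV hW (fun i => f (μ i)) ν σ hσ
  refine ⟨U, hU, ?_⟩
  rw [matFun_eq hB, hHW]
  exact hpos
end

section
/- (Brown–Kosaki trace inequality) Let f be a convex real function defined on an interval [a,b] with 0 ∈ [a,b] and f(0) ≤ 0, let A be an n×n Hermitian complex matrix whose spectrum lies in [a,b], and let Z be an n×n contraction (Z*Z ≤ I). Then Tr f(Z*AZ) ≤ Tr (Z* f(A) Z). -/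
open Matrix ComplexOrder

/-- Jensen's inequality for weights of total mass at most one,
the missing mass being put at `0`. -/
theorem ConvexOn.map_sum_le_of_sum_le_one {ι : Type*} {t : Finset ι} {s : Set ℝ} {f : ℝ → ℝ}
    {w p : ι → ℝ} (hf : ConvexOn ℝ s f) (h0 : 0 ∈ s) (hf0 : f 0 ≤ 0) (hw : ∀ i ∈ t, 0 ≤ w i)
    (hw1 : ∑ i ∈ t, w i ≤ 1) (hp : ∀ i ∈ t, p i ∈ s) :
    f (∑ i ∈ t, w i * p i) ≤ ∑ i ∈ t, w i * f (p i) := by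
  have h := hf.map_add_sum_le hw (sub_add_cancel 1 (∑ i ∈ t, w i)) hp (sub_nonneg.2 hw1) h0
  simp only [smul_eq_mul, mul_zero, zero_add] at h
  nlinarith [mul_nonneg (sub_nonneg.2 hw1) (neg_nonneg.2 hf0)]

theorem Matrix.conjTranspose_mul_diagonal_mul_apply_self {m n : Type*} [Fintype m] [DecidableEq m]
    (M : Matrix m n ℂ) (d : m → ℝ) (i : n) :
    (Mᴴ * diagonal (fun k => (d k : ℂ)) * M) i i =
      ((∑ k, Complex.normSq (M k i) * d k : ℝ) : ℂ) := by
  rw [mul_apply]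
  push_cast
  refine Finset.sum_congr rfl fun k _ => ?_
  rw [mul_diagonal, conjTranspose_apply, Complex.normSq_eq_conj_mul_self, ← Complex.star_def]
  ring

theorem Matrix.IsHermitian.eq_eigenvectorUnitary_mul_diagonal_mul_star {n : Type*} [Fintype n]
    [DecidableEq n] {A : Matrix n n ℂ} (hA : A.IsHermitian) :
    A = (hA.eigenvectorUnitary : Matrix n n ℂ) * diagonal (fun i => (hA.eigenvalues i : ℂ)) *
      star (hA.eigenvectorUnitary : Matrix n n ℂ) := by
  conv_lhs => rw [hA.spectral_theorem]
  rfl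

/-- Brown–Kosaki: for a convex `f` on `[a,b]` with `0 ∈ [a,b]`,
`f(0) ≤ 0`, a Hermitian `A` with spectrum in `[a,b]` and a contraction `Z`,
`Tr f(ZᴴAZ) ≤ Tr (Zᴴ f(A) Z)`. -/
theorem brown_kosaki_trace {n : ℕ} {a b : ℝ} {f : ℝ → ℝ}
    (hconv : ConvexOn ℝ (Set.Icc a b) f)
    (h0mem : (0 : ℝ) ∈ Set.Icc a b) (hf0 : f 0 ≤ 0)
    (A : Matrix (Fin n) (Fin n) ℂ) (hA : A.IsHermitian)
    (hspec : ∀ i, hA.eigenvalues i ∈ Set.Icc a b)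
    (Z : Matrix (Fin n) (Fin n) ℂ) (hZ : (1 - Zᴴ * Z).PosSemidef) :
    (matFun (Zᴴ * A * Z) f).trace ≤ (Zᴴ * matFun A f * Z).trace := by
  have hB : (Zᴴ * A * Z).IsHermitian := isHermitian_conjTranspose_mul_mul Z hA
  have hAd := hA.eq_eigenvectorUnitary_mul_diagonal_mul_star
  have hBd := hB.eq_eigenvectorUnitary_mul_diagonal_mul_star
  have hU : (hA.eigenvectorUnitary : Matrix (Fin n) (Fin n) ℂ) * star _ = 1 :=
    Unitary.coe_mul_star_self hA.eigenvectorUnitary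
  have hV : star (hB.eigenvectorUnitary : Matrix (Fin n) (Fin n) ℂ) * _ = 1 :=
    Unitary.coe_star_mul_self hB.eigenvectorUnitary
  have hV' : (hB.eigenvectorUnitary : Matrix (Fin n) (Fin n) ℂ) * star _ = 1 :=
    Unitary.coe_mul_star_self hB.eigenvectorUnitary
  rw [matFun, dif_pos hB, matFun, dif_pos hA]
  generalize (hA.eigenvectorUnitary : Matrix (Fin n) (Fin n) ℂ) = U at *
  generalize (hB.eigenvectorUnitary : Matrix (Fin n) (Fin n) ℂ) = V at *
  generalize hA.eigenvalues = l at *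
  generalize hB.eigenvalues = m at *
  simp only [star_eq_conjTranspose] at *
  set M := Uᴴ * Z * V with hM
  have hMM : Mᴴ * M = Vᴴ * (Zᴴ * Z) * V := by
    calc Mᴴ * M = Vᴴ * (Zᴴ * (U * Uᴴ) * Z) * V := by
          simp only [hM, conjTranspose_mul, conjTranspose_conjTranspose, Matrix.mul_assoc]
      _ = _ := by rw [hU, Matrix.mul_one]
  have hconj (D : Matrix (Fin n) (Fin n) ℂ) :
      Vᴴ * (Zᴴ * (U * D * Uᴴ) * Z) * V = Mᴴ * D * M := by
    simp only [hM, conjTranspose_mul, conjTranspose_conjTranspose, Matrix.mul_assoc]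
  have hcol (i : Fin n) : ∑ k, Complex.normSq (M k i) ≤ 1 := by
    have h := (hZ.conjTranspose_mul_mul_same V).diag_nonneg (i := i)
    rw [Matrix.mul_sub, Matrix.sub_mul, Matrix.mul_one, hV, ← hMM, Matrix.sub_apply, one_apply_eq] at h
    have h1 := conjTranspose_mul_diagonal_mul_apply_self M (fun _ => 1) i
    simp only [Complex.ofReal_one, diagonal_one, mul_one] at h1
    rw [h1, sub_nonneg] at h
    exact_mod_cast h
  have hm (i : Fin n) : m i = ∑ k, Complex.normSq (M k i) * l k := by
    have h : diagonal (fun i => (m i : ℂ)) = Mᴴ * diagonal (fun k => (l k : ℂ)) * M := by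
      rw [← hconj, ← hAd, hBd]
      calc _ = (Vᴴ * V) * diagonal (fun i => (m i : ℂ)) * (Vᴴ * V) := by simp [hV]
        _ = _ := by simp only [Matrix.mul_assoc]
    have h' := congrFun (congrFun h i) i
    rw [conjTranspose_mul_diagonal_mul_apply_self, diagonal_apply_eq] at h'
    exact_mod_cast h'
  have htr (X : Matrix (Fin n) (Fin n) ℂ) : X.trace = (Vᴴ * X * V).trace := by
    rw [trace_mul_cycle, hV', Matrix.one_mul]
  rw [trace_mul_cycle, hV, Matrix.one_mul, htr (Zᴴ * _ * Z), hconj, trace_diagonal, trace]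
  refine Finset.sum_le_sum fun i _ => ?_
  rw [diag_apply, conjTranspose_mul_diagonal_mul_apply_self M (fun k => f (l k)), hm i]
  exact_mod_cast hconv.map_sum_le_of_sum_le_one h0mem hf0 (fun k _ => Complex.normSq_nonneg _)
    (hcol i) fun k _ => hspec k
end

section
/- Let A and B be n×n Hermitian complex matrices and let f be an even convex real function on the real line. Then there exist n×n unitary matrices U and V such that f((A+B)/2) ≤ (U f(A) U* + V f(B) V*)/2 in the Loewner order. -/
open Matrix ComplexOrder

section Auxiliary

variable {n : ℕ}

lemma exists_unitary_matFun_eq {A : Matrix (Fin n) (Fin n) ℂ} (hA : A.IsHermitian) :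
    ∃ T ∈ unitaryGroup (Fin n) ℂ, ∃ a : Fin n → ℝ,
      A = T * diagonal (fun i => (a i : ℂ)) * star T ∧
      ∀ f, matFun A f = T * diagonal (fun i => (f (a i) : ℂ)) * star T := by
  refine ⟨hA.eigenvectorUnitary, hA.eigenvectorUnitary.2, hA.eigenvalues, ?_, fun f => ?_⟩
  · have h := hA.spectral_theorem
    rw [Unitary.conjStarAlgAut_apply] at h
    exact h
  · simp [matFun, hA]

lemma star_dotProduct_conj_diagonal (T : Matrix (Fin n) (Fin n) ℂ) (b : Fin n → ℝ)
    (v : Fin n → ℂ) :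
    star v ⬝ᵥ (T * diagonal (fun i => (b i : ℂ)) * star T) *ᵥ v =
      ((∑ i, b i * Complex.normSq ((star T *ᵥ v) i) : ℝ) : ℂ) := by
  have h : star v ᵥ* T = star (star T *ᵥ v) := by
    rw [star_mulVec, star_eq_conjTranspose, conjTranspose_conjTranspose]
  rw [← mulVec_mulVec, ← mulVec_mulVec, dotProduct_mulVec, h]
  simp only [dotProduct, mulVec_diagonal, Pi.star_apply]
  push_cast
  refine Finset.sum_congr rfl fun i _ => ?_
  rw [Complex.normSq_eq_conj_mul_self]
  simp only [Complex.star_def]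
  ring

lemma sum_normSq_star_mulVec_s8 {T : Matrix (Fin n) (Fin n) ℂ} (hT : T ∈ unitaryGroup (Fin n) ℂ)
    (v : Fin n → ℂ) :
    ∑ i, Complex.normSq ((star T *ᵥ v) i) = ∑ i, Complex.normSq (v i) := by
  have h := star_dotProduct_conj_diagonal T (fun _ => 1) v
  have h' := star_dotProduct_conj_diagonal 1 (fun _ => 1) v
  simp only [Complex.ofReal_one, diagonal_one, mul_one, one_mul, star_one, one_mulVec,
    mem_unitaryGroup_iff.1 hT] at h h'
  exact_mod_cast h.symm.trans h'

lemma sum_normSq_pos {v : Fin n → ℂ} (hv : v ≠ 0) : 0 < ∑ i, Complex.normSq (v i) := by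
  obtain ⟨i, hi⟩ := Function.ne_iff.1 hv
  exact Finset.sum_pos' (fun _ _ => Complex.normSq_nonneg _)
    ⟨i, Finset.mem_univ i, Complex.normSq_pos.2 hi⟩

/-- A dimension count: if the spectral subspace of `a` for values `≥ a i` meets the spectral
subspace of `b` for values `< c i` trivially, then `c` is dominated by a rearrangement of `b`. -/
lemma exists_perm_le {W T : Matrix (Fin n) (Fin n) ℂ} (hW : W ∈ unitaryGroup (Fin n) ℂ)
    {a b c : Fin n → ℝ}
    (h : ∀ i v, (∀ j, a j < a i → (star W *ᵥ v) j = 0) →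
      (∀ j, c i ≤ b j → (star T *ᵥ v) j = 0) → v = 0) :
    ∃ σ : Equiv.Perm (Fin n), ∀ i, c i ≤ b (σ i) := by
  classical
  have hcard : ∀ i, Fintype.card {j // a i ≤ a j} ≤ Fintype.card {j // c i ≤ b j} := by
    intro i
    let L : ({j // a i ≤ a j} → ℂ) →ₗ[ℂ] ({j // c i ≤ b j} → ℂ) :=
      LinearMap.funLeft ℂ ℂ Subtype.val ∘ₗ toLin' (star T * W) ∘ₗ
        Function.ExtendByZero.linearMap ℂ Subtype.val
    have hL : Function.Injective L := by
      rw [← LinearMap.ker_eq_bot, LinearMap.ker_eq_bot']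
      intro x hx
      set y : Fin n → ℂ := Function.extend Subtype.val x 0 with hy
      have hWy : star W *ᵥ (W *ᵥ y) = y := by
        rw [mulVec_mulVec, mem_unitaryGroup_iff'.1 hW, one_mulVec]
      have h0 : W *ᵥ y = 0 := by
        refine h i _ (fun j hj => ?_) fun j hj => ?_
        · rw [hWy, hy, Function.extend_apply']
          · rfl
          · rintro ⟨k, rfl⟩
            exact absurd k.2 (not_le.2 hj)
        · have := congrFun hx ⟨j, hj⟩
          rw [mulVec_mulVec]
          exact this
      have hy0 : y = 0 := by rw [← hWy, h0, mulVec_zero]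
      ext k
      have := congrFun hy0 k.1
      rwa [hy, Subtype.val_injective.extend_apply] at this
    simpa using LinearMap.finrank_le_finrank_of_injective hL
  have hall : ∀ s : Finset (Fin n),
      s.card ≤ (s.biUnion fun i => Finset.univ.filter fun j => c i ≤ b j).card := by
    intro s
    rcases s.eq_empty_or_nonempty with rfl | hs
    · simp
    obtain ⟨i, hi, hmin⟩ := s.exists_min_image a hs
    calc s.card ≤ (Finset.univ.filter fun j => a i ≤ a j).card :=
          Finset.card_le_card fun j hj => by simpa using hmin j hj
      _ ≤ (Finset.univ.filter fun j => c i ≤ b j).card := by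
          simpa only [Fintype.card_subtype] using hcard i
      _ ≤ _ := Finset.card_le_card
          (Finset.subset_biUnion_of_mem (fun i => Finset.univ.filter fun j => c i ≤ b j) hi)
  obtain ⟨g, hg, hgt⟩ := (Finset.all_card_le_biUnion_card_iff_exists_injective _).1 hall
  exact ⟨Equiv.ofBijective g (Finite.injective_iff_bijective.1 hg),
    fun i => by simpa using hgt i⟩

lemma exists_unitary_conj_le {W T : Matrix (Fin n) (Fin n) ℂ}
    (hW : W ∈ unitaryGroup (Fin n) ℂ) (hT : T ∈ unitaryGroup (Fin n) ℂ) {a b : Fin n → ℝ}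
    (σ : Equiv.Perm (Fin n)) (h : ∀ i, a i ≤ b (σ i)) :
    ∃ R ∈ unitaryGroup (Fin n) ℂ,
      (R * (T * diagonal (fun i => (b i : ℂ)) * star T) * star R -
        W * diagonal (fun i => (a i : ℂ)) * star W).PosSemidef := by
  set P : Matrix (Fin n) (Fin n) ℂ := (1 : Matrix (Fin n) (Fin n) ℂ).submatrix σ id with hP
  have hPs : star P = (1 : Matrix (Fin n) (Fin n) ℂ).submatrix id σ := by
    rw [hP, star_eq_conjTranspose, conjTranspose_submatrix, conjTranspose_one]
  have hPd : P * diagonal (fun i => (b i : ℂ)) * star P =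
      diagonal (fun i => (b (σ i) : ℂ)) := by
    ext i j
    rw [hPs, mul_apply]
    by_cases hij : i = j
    · subst hij; simp [hP, mul_diagonal, one_apply]
    · simp [hP, mul_diagonal, one_apply, hij]
  have hPu : P ∈ unitaryGroup (Fin n) ℂ := by
    rw [mem_unitaryGroup_iff, hPs]
    ext i j
    simp [hP, mul_apply, one_apply]
  refine ⟨W * P * star T, mul_mem (mul_mem hW hPu) (Unitary.star_mem hT), ?_⟩
  have hTT := mem_unitaryGroup_iff'.1 hT
  have key : W * P * star T * (T * diagonal (fun i => (b i : ℂ)) * star T) *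
      star (W * P * star T) - W * diagonal (fun i => (a i : ℂ)) * star W =
      W * diagonal (fun i => ((b (σ i) - a i : ℝ) : ℂ)) * star W := by
    have h1 : W * P * star T * (T * diagonal (fun i => (b i : ℂ)) * star T) *
        star (W * P * star T) = W * (P * diagonal (fun i => (b i : ℂ)) * star P) * star W := by
      rw [star_mul, star_mul, star_star]
      calc _ = W * P * (star T * T) * diagonal (fun i => (b i : ℂ)) * (star T * T) *
            (star P * star W) := by simp only [mul_assoc]
        _ = _ := by rw [hTT]; simp only [mul_assoc, mul_one]
    rw [h1, hPd, ← sub_mul, ← mul_sub, diagonal_sub]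
    simp
  rw [key, star_eq_conjTranspose]
  refine PosSemidef.mul_mul_conjTranspose_same (posSemidef_diagonal_iff.2 fun i => ?_) W
  exact_mod_cast sub_nonneg.2 (h i)

lemma monotone_comp_max_zero {f : ℝ → ℝ} (hconv : ConvexOn ℝ Set.univ f)
    (heven : ∀ t, f (-t) = f t) : Monotone fun t => f (max t 0) := by
  intro x y hxy
  have h := hconv.le_max_of_mem_Icc (Set.mem_univ (-max y 0)) (Set.mem_univ (max y 0))
    (z := max x 0) ⟨by linarith [le_max_right x 0, le_max_right y 0], max_le_max_right 0 hxy⟩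
  simpa [heven] using h

lemma convexOn_comp_max_zero {f : ℝ → ℝ} (hconv : ConvexOn ℝ Set.univ f)
    (heven : ∀ t, f (-t) = f t) : ConvexOn ℝ Set.univ fun t => f (max t 0) := by
  refine ⟨convex_univ, fun x _ y _ a b ha hb hab => ?_⟩
  refine le_trans ?_ (hconv.2 (Set.mem_univ (max x 0)) (Set.mem_univ (max y 0)) ha hb hab)
  have h0 : 0 ≤ a • max x 0 + b • max y 0 := by
    simp only [smul_eq_mul]; positivity
  have h1 : a • x + b • y ≤ a • max x 0 + b • max y 0 := by
    simp only [smul_eq_mul]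
    gcongr <;> exact le_max_left _ _
  have := monotone_comp_max_zero hconv heven h1
  simpa only [max_eq_left h0] using this

/-- The eigenvalues of the symmetrized product `(S A + A S) / 2` with a Hermitian unitary `S` are
dominated by the absolute values of the eigenvalues of `A`. -/
lemma exists_perm_le_abs {A S T X : Matrix (Fin n) (Fin n) ℂ} {α χ : Fin n → ℝ}
    {V : Matrix (Fin n) (Fin n) ℂ}
    (hT : T ∈ unitaryGroup (Fin n) ℂ) (hA : A = T * diagonal (fun i => (α i : ℂ)) * star T)
    (hAh : A.IsHermitian) (hS : S.IsHermitian) (hSS : S * S = 1)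
    (hV : V ∈ unitaryGroup (Fin n) ℂ) (hX : X = V * diagonal (fun i => (χ i : ℂ)) * star V)
    (hXS : (2 : ℂ) • X = S * A + A * S) :
    ∃ σ : Equiv.Perm (Fin n), ∀ i, χ i ≤ |α (σ i)| := by
  refine exists_perm_le (T := T) hV (a := χ) (b := fun i => |α i|) (c := χ) fun i v h1 h2 => ?_
  by_contra hv
  have hTv := sum_normSq_star_mulVec_s8 hT v
  have hVv := sum_normSq_star_mulVec_s8 hV v
  have hpos := sum_normSq_pos hv
  set t := χ i with ht
  have ht0 : 0 < t := by
    by_contra! hle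
    have : ∑ j, Complex.normSq ((star T *ᵥ v) j) = 0 :=
      Finset.sum_eq_zero fun j _ => by rw [h2 j (hle.trans (abs_nonneg _)), map_zero]
    linarith
  have hAA : A * A = T * diagonal (fun i => ((α i ^ 2 : ℝ) : ℂ)) * star T := by
    have hTT := mem_unitaryGroup_iff'.1 hT
    calc A * A = T * diagonal (fun i => (α i : ℂ)) * (star T * T) *
          diagonal (fun i => (α i : ℂ)) * star T := by rw [hA]; simp only [mul_assoc]
      _ = _ := by
          rw [hTT, mul_one, mul_assoc T, diagonal_mul_diagonal]
          simp [sq]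
  have hpsd := (posSemidef_conjTranspose_mul_self (A - (t : ℂ) • S)).dotProduct_mulVec_nonneg v
  have hexp : (A - (t : ℂ) • S)ᴴ * (A - (t : ℂ) • S) =
      A * A - ((2 * t : ℝ) : ℂ) • X + ((t ^ 2 : ℝ) : ℂ) • (1 : Matrix (Fin n) (Fin n) ℂ) := by
    have h2t : ((2 * t : ℝ) : ℂ) • X = (t : ℂ) • (S * A + A * S) := by
      rw [← hXS, smul_smul]; push_cast; rw [mul_comm]
    rw [h2t, ← hSS, conjTranspose_sub, conjTranspose_smul, hAh.eq, hS.eq]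
    simp only [sub_mul, mul_sub, smul_mul_assoc, mul_smul_comm, Complex.star_def,
      Complex.conj_ofReal, smul_add, smul_sub, mul_smul, sq, Complex.ofReal_mul]
    abel
  have hone : star v ⬝ᵥ v = ((∑ i, Complex.normSq (v i) : ℝ) : ℂ) := by
    have := star_dotProduct_conj_diagonal 1 (fun _ => 1) v
    simpa using this
  rw [hexp, add_mulVec, sub_mulVec, smul_mulVec, smul_mulVec, dotProduct_add, dotProduct_sub,
    dotProduct_smul, dotProduct_smul, one_mulVec, hone, hAA, hX, star_dotProduct_conj_diagonal,
    star_dotProduct_conj_diagonal] at hpsd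
  simp only [smul_eq_mul] at hpsd
  have hreal : 0 ≤ (∑ i, α i ^ 2 * Complex.normSq ((star T *ᵥ v) i)) -
      2 * t * (∑ i, χ i * Complex.normSq ((star V *ᵥ v) i)) +
      t ^ 2 * ∑ i, Complex.normSq (v i) := by exact_mod_cast hpsd
  have hlow : t * ∑ i, Complex.normSq (v i) ≤ ∑ i, χ i * Complex.normSq ((star V *ᵥ v) i) := by
    rw [← hVv, Finset.mul_sum]
    refine Finset.sum_le_sum fun j _ => ?_
    rcases lt_or_ge (χ j) t with hj | hj
    · simp [h1 j hj]
    · exact mul_le_mul_of_nonneg_right hj (Complex.normSq_nonneg _)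
  have hup : ∑ i, α i ^ 2 * Complex.normSq ((star T *ᵥ v) i) <
      t ^ 2 * ∑ i, Complex.normSq (v i) := by
    rw [← hTv] at hpos ⊢
    obtain ⟨k, -, hk⟩ := Finset.exists_ne_zero_of_sum_ne_zero hpos.ne'
    have hlt : ∀ j, Complex.normSq ((star T *ᵥ v) j) ≠ 0 → α j ^ 2 < t ^ 2 := by
      intro j hj
      rw [sq_lt_sq, abs_of_pos ht0]
      by_contra! hle
      exact hj (by rw [h2 j hle, map_zero])
    rw [Finset.mul_sum]
    refine Finset.sum_lt_sum (fun j _ => ?_) ⟨k, Finset.mem_univ k, ?_⟩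
    · by_cases hj : Complex.normSq ((star T *ᵥ v) j) = 0
      · simp [hj]
      · exact mul_le_mul_of_nonneg_right (hlt j hj).le (Complex.normSq_nonneg _)
    · exact mul_lt_mul_of_pos_right (hlt k hk) (lt_of_le_of_ne (Complex.normSq_nonneg _) hk.symm)
  nlinarith [mul_le_mul_of_nonneg_left hlow ht0.le]

/-- Jensen's inequality for the quadratic form of a function of a Hermitian matrix. -/
lemma map_sum_normSq_le {h : ℝ → ℝ} (hh : ConvexOn ℝ Set.univ h)
    {T : Matrix (Fin n) (Fin n) ℂ} (hT : T ∈ unitaryGroup (Fin n) ℂ) (a : Fin n → ℝ)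
    {v : Fin n → ℂ} (hv : ∑ i, Complex.normSq (v i) = 1) :
    h (∑ i, a i * Complex.normSq ((star T *ᵥ v) i)) ≤
      ∑ i, h (a i) * Complex.normSq ((star T *ᵥ v) i) := by
  have := hh.map_sum_le (t := Finset.univ) (w := fun i => Complex.normSq ((star T *ᵥ v) i))
    (p := a) (fun _ _ => Complex.normSq_nonneg _) ((sum_normSq_star_mulVec_s8 hT v).trans hv)
    (fun _ _ => Set.mem_univ _)
  simpa only [smul_eq_mul, mul_comm] using this

/-- Eigenvalue domination of `h ((X + Y) / 2)` by `(h X + h Y) / 2` for monotone convex `h`. -/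
lemma exists_perm_le_of_monotone_convex {h : ℝ → ℝ} (hm : Monotone h)
    (hc : ConvexOn ℝ Set.univ h) {W T V R : Matrix (Fin n) (Fin n) ℂ} {a b χ η : Fin n → ℝ}
    (hW : W ∈ unitaryGroup (Fin n) ℂ) (hT : T ∈ unitaryGroup (Fin n) ℂ)
    (hV : V ∈ unitaryGroup (Fin n) ℂ) (hR : R ∈ unitaryGroup (Fin n) ℂ)
    (hsum : (2 : ℂ) • (W * diagonal (fun i => (a i : ℂ)) * star W) =
      V * diagonal (fun i => (χ i : ℂ)) * star V + R * diagonal (fun i => (η i : ℂ)) * star R)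
    (hfun : (2 : ℂ) • (T * diagonal (fun i => (b i : ℂ)) * star T) =
      V * diagonal (fun i => (h (χ i) : ℂ)) * star V +
        R * diagonal (fun i => (h (η i) : ℂ)) * star R) :
    ∃ σ : Equiv.Perm (Fin n), ∀ i, h (a i) ≤ b (σ i) := by
  refine exists_perm_le (T := T) hW (a := a) (c := fun i => h (a i)) fun i u h1 h2 => ?_
  by_contra hu
  have hpos := sum_normSq_pos hu
  set r : ℝ := (√(∑ i, Complex.normSq (u i)))⁻¹ with hr
  set v : Fin n → ℂ := (r : ℂ) • u with hv
  have hv1 : ∑ i, Complex.normSq (v i) = 1 := by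
    simp only [hv, Pi.smul_apply, smul_eq_mul, map_mul, Complex.normSq_ofReal]
    rw [← Finset.mul_sum, hr, ← mul_inv, Real.mul_self_sqrt hpos.le, inv_mul_cancel₀ hpos.ne']
  have h1 : ∀ j, a j < a i → (star W *ᵥ v) j = 0 := fun j hj => by
    simp [hv, mulVec_smul, h1 j hj]
  have h2 : ∀ j, h (a i) ≤ b j → (star T *ᵥ v) j = 0 := fun j hj => by
    simp [hv, mulVec_smul, h2 j hj]
  have hWv := (sum_normSq_star_mulVec_s8 hW v).trans hv1
  have hTv := (sum_normSq_star_mulVec_s8 hT v).trans hv1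
  have e1 := congrArg (fun M => star v ⬝ᵥ M *ᵥ v) hsum
  have e2 := congrArg (fun M => star v ⬝ᵥ M *ᵥ v) hfun
  simp only [smul_mulVec, dotProduct_smul, add_mulVec, dotProduct_add,
    star_dotProduct_conj_diagonal] at e1
  simp only [smul_mulVec, dotProduct_smul, add_mulVec, dotProduct_add] at e2
  rw [star_dotProduct_conj_diagonal, star_dotProduct_conj_diagonal V (fun i => h (χ i)),
    star_dotProduct_conj_diagonal R (fun i => h (η i))] at e2
  simp only [smul_eq_mul] at e1 e2
  have E1 : 2 * ∑ i, a i * Complex.normSq ((star W *ᵥ v) i) =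
      ∑ i, χ i * Complex.normSq ((star V *ᵥ v) i) +
        ∑ i, η i * Complex.normSq ((star R *ᵥ v) i) := by exact_mod_cast e1
  have E2 : 2 * ∑ i, b i * Complex.normSq ((star T *ᵥ v) i) =
      ∑ i, h (χ i) * Complex.normSq ((star V *ᵥ v) i) +
        ∑ i, h (η i) * Complex.normSq ((star R *ᵥ v) i) := by exact_mod_cast e2
  have J1 := map_sum_normSq_le hc hV χ hv1
  have J2 := map_sum_normSq_le hc hR η hv1
  set p := ∑ i, χ i * Complex.normSq ((star V *ᵥ v) i)
  set q := ∑ i, η i * Complex.normSq ((star R *ᵥ v) i)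
  have J3 := hc.2 (Set.mem_univ p) (Set.mem_univ q) (by norm_num : (0 : ℝ) ≤ 1 / 2)
    (by norm_num : (0 : ℝ) ≤ 1 / 2) (by norm_num)
  simp only [smul_eq_mul] at J3
  have hlow : a i ≤ 1 / 2 * p + 1 / 2 * q := by
    have : a i * ∑ j, Complex.normSq ((star W *ᵥ v) j) ≤
        ∑ j, a j * Complex.normSq ((star W *ᵥ v) j) := by
      rw [Finset.mul_sum]
      refine Finset.sum_le_sum fun j _ => ?_
      rcases lt_or_ge (a j) (a i) with hj | hj
      · simp [h1 j hj]
      · exact mul_le_mul_of_nonneg_right hj (Complex.normSq_nonneg _)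
    rw [hWv] at this
    linarith
  have hup : ∑ j, b j * Complex.normSq ((star T *ᵥ v) j) < h (a i) := by
    have hne : ∑ j, Complex.normSq ((star T *ᵥ v) j) ≠ 0 := by rw [hTv]; norm_num
    obtain ⟨k, -, hk⟩ := Finset.exists_ne_zero_of_sum_ne_zero hne
    have hlt : ∀ j, Complex.normSq ((star T *ᵥ v) j) ≠ 0 → b j < h (a i) := by
      intro j hj
      by_contra! hle
      exact hj (by rw [h2 j hle, map_zero])
    rw [← mul_one (h (a i)), ← hTv, Finset.mul_sum]
    refine Finset.sum_lt_sum (fun j _ => ?_) ⟨k, Finset.mem_univ k, ?_⟩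
    · by_cases hj : Complex.normSq ((star T *ᵥ v) j) = 0
      · simp [hj]
      · exact mul_le_mul_of_nonneg_right (hlt j hj).le (Complex.normSq_nonneg _)
    · exact mul_lt_mul_of_pos_right (hlt k hk) (lt_of_le_of_ne (Complex.normSq_nonneg _) hk.symm)
  linarith [hm hlow]

lemma isHermitian_conj_diagonal (T : Matrix (Fin n) (Fin n) ℂ) (a : Fin n → ℝ) :
    (T * diagonal (fun i => (a i : ℂ)) * star T).IsHermitian :=
  isHermitian_mul_mul_conjTranspose T
    (isHermitian_diagonal_of_self_adjoint _ (by ext i; simp))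

/-- For even convex `f` and a Hermitian unitary `S`, the symmetrized product `X = (S A + A S) / 2`
satisfies `f (X⁺) ≤ U f(A) U*` for some unitary `U`. -/
lemma exists_symmetrized_le {f : ℝ → ℝ} (hconv : ConvexOn ℝ Set.univ f)
    (heven : ∀ t, f (-t) = f t) {A S : Matrix (Fin n) (Fin n) ℂ} (hA : A.IsHermitian)
    (hS : S.IsHermitian) (hSS : S * S = 1) :
    ∃ V ∈ unitaryGroup (Fin n) ℂ, ∃ χ : Fin n → ℝ,
      V * diagonal (fun i => (χ i : ℂ)) * star V = (2 : ℂ)⁻¹ • (S * A + A * S) ∧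
      ∃ U ∈ unitaryGroup (Fin n) ℂ, (U * matFun A f * star U -
        V * diagonal (fun i => (f (max (χ i) 0) : ℂ)) * star V).PosSemidef := by
  obtain ⟨T, hT, α, hAT, hfA⟩ := exists_unitary_matFun_eq hA
  have hX : ((2 : ℂ)⁻¹ • (S * A + A * S)).IsHermitian := by
    rw [IsHermitian, conjTranspose_smul, conjTranspose_add, conjTranspose_mul,
      conjTranspose_mul, hA.eq, hS.eq, add_comm]
    simp
  obtain ⟨V, hV, χ, hXV, -⟩ := exists_unitary_matFun_eq hX
  obtain ⟨σ, hσ⟩ := exists_perm_le_abs hT hAT hA hS hSS hV hXV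
    (by rw [smul_smul]; norm_num)
  refine ⟨V, hV, χ, hXV.symm, ?_⟩
  rw [hfA]
  refine exists_unitary_conj_le (a := fun i => f (max (χ i) 0)) (b := fun i => f (α i))
    hV hT σ fun i => ?_
  have h := monotone_comp_max_zero hconv heven (hσ i)
  simp only [max_eq_left (abs_nonneg (α (σ i)))] at h
  rcases abs_choice (α (σ i)) with h' | h' <;> rw [h'] at h
  · exact h
  · rwa [heven] at h

end Auxiliary

/-- for Hermitian `A`, `B` and an even convex `f : ℝ → ℝ`, there are
unitaries `U`, `V` with `f((A+B)/2) ≤ (U f(A) Uᴴ + V f(B) Vᴴ)/2`. -/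
theorem even_convex_two_unitaries {n : ℕ} {f : ℝ → ℝ}
    (hconv : ConvexOn ℝ Set.univ f) (heven : ∀ t, f (-t) = f t)
    (A B : Matrix (Fin n) (Fin n) ℂ) (hA : A.IsHermitian) (hB : B.IsHermitian) :
    ∃ U V : Matrix (Fin n) (Fin n) ℂ, Uᴴ * U = 1 ∧ Vᴴ * V = 1 ∧
      ((2 : ℂ)⁻¹ • (U * matFun A f * Uᴴ + V * matFun B f * Vᴴ) -
        matFun ((2 : ℂ)⁻¹ • (A + B)) f).PosSemidef := by
  have hC : ((2 : ℂ)⁻¹ • (A + B)).IsHermitian := by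
    rw [IsHermitian, conjTranspose_smul, (hA.add hB).eq]
    simp
  set C := (2 : ℂ)⁻¹ • (A + B) with hCdef
  obtain ⟨W, hW, c, hCW, hfC⟩ := exists_unitary_matFun_eq hC
  have hWW := mem_unitaryGroup_iff'.1 hW
  set s : Fin n → ℝ := fun i => if 0 ≤ c i then 1 else -1 with hs
  have hsc : ∀ i, s i * c i = |c i| := fun i => by
    by_cases h : 0 ≤ c i
    · simp [hs, h, abs_of_nonneg h]
    · simp [hs, h, abs_of_neg (not_le.1 h)]
  have hss : ∀ i, s i * s i = 1 := fun i => by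
    by_cases h : 0 ≤ c i <;> simp [hs, h]
  have hmul : ∀ x y : Fin n → ℝ, (W * diagonal (fun i => (x i : ℂ)) * star W) *
      (W * diagonal (fun i => (y i : ℂ)) * star W) =
      W * diagonal (fun i => ((x i * y i : ℝ) : ℂ)) * star W := fun x y => by
    calc _ = W * diagonal (fun i => (x i : ℂ)) * (star W * W) *
          diagonal (fun i => (y i : ℂ)) * star W := by simp only [mul_assoc]
      _ = _ := by
          rw [hWW, mul_one, mul_assoc W, diagonal_mul_diagonal]
          simp
  set S := W * diagonal (fun i => (s i : ℂ)) * star W with hSdef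
  have hS : S.IsHermitian := isHermitian_conj_diagonal W s
  have hSS : S * S = 1 := by
    rw [hSdef, hmul]
    simp only [hss, Complex.ofReal_one, diagonal_one, mul_one]
    exact mem_unitaryGroup_iff.1 hW
  have hSC : S * C = W * diagonal (fun i => ((|c i| : ℝ) : ℂ)) * star W := by
    rw [hSdef, hCW, hmul]
    simp only [hsc]
  have hCS : C * S = W * diagonal (fun i => ((|c i| : ℝ) : ℂ)) * star W := by
    rw [hSdef, hCW, hmul]
    simp only [mul_comm (c _), hsc]
  obtain ⟨V₁, hV₁, χ, hX, U₁, hU₁, hle₁⟩ := exists_symmetrized_le hconv heven hA hS hSS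
  obtain ⟨V₂, hV₂, η, hY, U₂, hU₂, hle₂⟩ := exists_symmetrized_le hconv heven hB hS hSS
  set F := V₁ * diagonal (fun i => (f (max (χ i) 0) : ℂ)) * star V₁ with hF
  set G := V₂ * diagonal (fun i => (f (max (η i) 0) : ℂ)) * star V₂ with hG
  have hK : ((2 : ℂ)⁻¹ • (F + G)).IsHermitian := by
    have hFh : F.IsHermitian := isHermitian_conj_diagonal V₁ fun i => f (max (χ i) 0)
    have hGh : G.IsHermitian := isHermitian_conj_diagonal V₂ fun i => f (max (η i) 0)
    rw [IsHermitian, conjTranspose_smul, (hFh.add hGh).eq]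
    simp
  obtain ⟨T, hT, b, hKT, -⟩ := exists_unitary_matFun_eq hK
  obtain ⟨σ, hσ⟩ := exists_perm_le_of_monotone_convex (monotone_comp_max_zero hconv heven)
    (convexOn_comp_max_zero hconv heven) (a := fun i => |c i|) hW hT hV₁ hV₂
    (by
      have h2 : (2 : ℂ) • (S * C) = S * C + C * S := by rw [hSC, hCS, two_smul]
      rw [← hSC, hX, hY, h2, hCdef]
      simp only [mul_smul_comm, smul_mul_assoc, mul_add, add_mul, smul_add]
      abel)
    (by rw [← hKT, smul_smul]; norm_num [hF, hG])
  have hσ' : ∀ i, f (c i) ≤ b (σ i) := fun i => by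
    have h := hσ i
    simp only [max_eq_left (abs_nonneg (c i))] at h
    rcases abs_choice (c i) with h' | h' <;> rw [h'] at h
    · exact h
    · rwa [heven] at h
  obtain ⟨R, hR, hle⟩ := exists_unitary_conj_le (a := fun i => f (c i)) hW hT σ hσ'
  rw [← hKT, ← hfC] at hle
  refine ⟨R * U₁, R * U₂, mem_unitaryGroup_iff'.1 (mul_mem hR hU₁),
    mem_unitaryGroup_iff'.1 (mul_mem hR hU₂), ?_⟩
  have hsum := ((hle₁.add hle₂).mul_mul_conjTranspose_same R).smul
    (inv_nonneg.2 (zero_le_two (α := ℂ)))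
  convert hsum.add hle using 1
  simp only [star_eq_conjTranspose, conjTranspose_mul, mul_add, add_mul, mul_sub, sub_mul,
    smul_add, smul_sub, mul_smul_comm, smul_mul_assoc, mul_assoc]
  abel
end

section
/- Let f : [0,∞) → [0,∞) be a continuous function with f(0) = 0. If for every n, every positive semidefinite n×n complex matrix A and every n×n contraction Z (Z*Z ≤ I) one has Tr f(Z*AZ) ≤ Tr (Z* f(A) Z), then f is convex on [0,∞). -/
open Matrix ComplexOrder

/-- The spectral functional calculus acts entrywise on real diagonal matrices. -/
theorem matFun_diagonal {n : ℕ} (d : Fin n → ℝ) (f : ℝ → ℝ) :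
    matFun (Matrix.diagonal fun i => (d i : ℂ)) f = Matrix.diagonal fun i => (f (d i) : ℂ) := by
  have h : (Matrix.diagonal fun i => (d i : ℂ)).IsHermitian :=
    Matrix.isHermitian_diagonal_of_self_adjoint _ (by ext i; simp)
  rw [matFun, dif_pos h]
  set U : Matrix (Fin n) (Fin n) ℂ := (h.eigenvectorUnitary : Matrix (Fin n) (Fin n) ℂ)
  have hUU : U * star U = 1 := Unitary.coe_mul_star_self _
  have hUU' : star U * U = 1 := Unitary.coe_star_mul_self _
  have hspec : (Matrix.diagonal fun i => (d i : ℂ)) * U =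
      U * Matrix.diagonal fun i => (h.eigenvalues i : ℂ) := by
    have hs := h.spectral_theorem
    rw [Unitary.conjStarAlgAut_apply] at hs
    conv_lhs => rw [hs]
    rw [Matrix.mul_assoc, hUU', Matrix.mul_one]
    rfl
  have hf : (Matrix.diagonal fun i => (f (d i) : ℂ)) * U =
      U * Matrix.diagonal fun i => (f (h.eigenvalues i) : ℂ) := by
    ext i j
    have hij := congrFun (congrFun hspec i) j
    rw [Matrix.diagonal_mul, Matrix.mul_diagonal, mul_comm] at hij ⊢
    rcases eq_or_ne (U i j) 0 with h0 | h0
    · simp [h0]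
    · rw [Complex.ofReal_injective (mul_left_cancel₀ h0 hij)]
  rw [← hf, Matrix.mul_assoc, hUU, Matrix.mul_one]

/-- if `f : [0,∞) → [0,∞)` is continuous with `f(0) = 0` and the
Brown–Kosaki trace inequality holds for all positive semidefinite `A` and all
contractions `Z` (of any size), then `f` is convex on `[0,∞)`. -/
theorem trace_inequality_implies_convex {f : ℝ → ℝ}
    (hcont : ContinuousOn f (Set.Ici 0)) (hf0 : f 0 = 0)
    (hnonneg : ∀ x ∈ Set.Ici (0 : ℝ), 0 ≤ f x)
    (H : ∀ n : ℕ, ∀ A : Matrix (Fin n) (Fin n) ℂ, A.PosSemidef →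
      ∀ Z : Matrix (Fin n) (Fin n) ℂ, (1 - Zᴴ * Z).PosSemidef →
        (matFun (Zᴴ * A * Z) f).trace ≤ (Zᴴ * matFun A f * Z).trace) :
    ConvexOn ℝ (Set.Ici 0) f := by
  refine ⟨convex_Ici 0, fun x hx y hy a b ha hb hab => ?_⟩
  have hx' : 0 ≤ x := hx
  have hy' : 0 ≤ y := hy
  set Z : Matrix (Fin 2) (Fin 2) ℂ := !![(√a : ℂ), 0; (√b : ℂ), 0] with hZ
  have ha2 : (√a : ℂ) * √a = a := by rw [← Complex.ofReal_mul, Real.mul_self_sqrt ha]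
  have hb2 : (√b : ℂ) * √b = b := by rw [← Complex.ofReal_mul, Real.mul_self_sqrt hb]
  have hconj (p q : ℝ) : Zᴴ * (Matrix.diagonal fun i => ((![p, q] i : ℝ) : ℂ)) * Z =
      Matrix.diagonal fun i => ((![a * p + b * q, 0] i : ℝ) : ℂ) := by
    ext i j
    fin_cases i <;> fin_cases j <;>
      simp [hZ, Matrix.mul_apply, Fin.sum_univ_two, Matrix.diagonal_apply]
    linear_combination (p : ℂ) * ha2 + q * hb2
  have hA : (Matrix.diagonal fun i => ((![x, y] i : ℝ) : ℂ)).PosSemidef := by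
    refine Matrix.PosSemidef.diagonal fun i => ?_
    fin_cases i <;> simp [hx', hy']
  have hZc : (1 - Zᴴ * Z).PosSemidef := by
    have hone : (Matrix.diagonal fun i => ((![1, 1] i : ℝ) : ℂ)) = 1 := by
      ext i j
      fin_cases i <;> fin_cases j <;> simp
    have hZZ := hconj 1 1
    rw [hone, Matrix.mul_one] at hZZ
    rw [hZZ, ← Matrix.diagonal_one, Matrix.diagonal_sub]
    refine Matrix.PosSemidef.diagonal fun i => ?_
    fin_cases i <;> simp [hab]
  have key := H 2 _ hA Z hZc
  have hfA : (fun i => (f (![x, y] i) : ℂ)) = fun i => ((![f x, f y] i : ℝ) : ℂ) := by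
    ext i
    fin_cases i <;> rfl
  rw [hconj, matFun_diagonal, matFun_diagonal, hfA, hconj, Matrix.trace_diagonal,
    Matrix.trace_diagonal, Fin.sum_univ_two, Fin.sum_univ_two] at key
  simp only [Matrix.cons_val_zero, Matrix.cons_val_one, hf0, Complex.ofReal_zero,
    add_zero] at key
  simpa only [smul_eq_mul] using Complex.real_le_real.mp key
end
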